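/- arXiv:1301.6911 — 3 statements merged into one kernel-verified Lean document; each statement's English description precedes it below -/
import Mathlib

section
/- Let ρ be the Gaussian measure N(0, σ²) on ℝ. Then the Cramér transform of the law of (Z, Z²), Z ~ N(0,σ²), is given by I(x,y) = (1/2)(y/σ² − 1 − ln((y − x²)/σ²)) for x² < y, and satisfies I(x,y) − x²/(2y) ~ x⁴/(4σ⁴) + (y−σ²)²/(4σ⁴) as (x,y) → (0, σ²). -/
open MeasureTheory ENNReal
open scoped NNReal

/-- The log-Laplace transform of the law of `(Z, Z^2)` for `Z ~ ρ`, as a function into `ℝ≥0∞`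
before taking logarithms. -/
noncomputable def lapCW (ρ : Measure ℝ) (u v : ℝ) : ℝ≥0∞ :=
  ∫⁻ z, ENNReal.ofReal (Real.exp (u * z + v * z ^ 2)) ∂ρ

/-- The Cramér transform `I` of the law of `(Z, Z^2)` for `Z ~ ρ`, with values in `EReal`. -/
noncomputable def cramCW (ρ : Measure ℝ) (x y : ℝ) : EReal :=
  ⨆ p : ℝ × ℝ, (((x * p.1 + y * p.2 : ℝ) : EReal) - ENNReal.log (lapCW ρ p.1 p.2))

open ProbabilityTheory

theorem ofReal_integral_le_lintegral_ofReal {α : Type*} [MeasurableSpace α] {μ : Measure α}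
    {f : α → ℝ} (hf : Integrable f μ) :
    ENNReal.ofReal (∫ a, f a ∂μ) ≤ ∫⁻ a, ENNReal.ofReal (f a) ∂μ := by
  rw [integral_eq_lintegral_pos_part_sub_lintegral_neg_part hf]
  exact (ENNReal.ofReal_le_ofReal (sub_le_self _ ENNReal.toReal_nonneg)).trans
    ENNReal.ofReal_toReal_le

/-- Jensen's inequality for the exponential, without integrability of `exp ∘ f`. -/
theorem ofReal_exp_integral_le_lintegral {α : Type*} [MeasurableSpace α] {μ : Measure α}
    [IsProbabilityMeasure μ] {f : α → ℝ} (hf : Integrable f μ) :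
    ENNReal.ofReal (Real.exp (∫ a, f a ∂μ)) ≤ ∫⁻ a, ENNReal.ofReal (Real.exp (f a)) ∂μ := by
  set m := ∫ a, f a ∂μ with hm
  have hg : Integrable (fun a => Real.exp m * (f a + (1 - m))) μ :=
    (hf.add (integrable_const _)).const_mul _
  have hgi : ∫ a, Real.exp m * (f a + (1 - m)) ∂μ = Real.exp m := by
    rw [integral_const_mul, integral_add hf (integrable_const _), ← hm]
    simp
  calc ENNReal.ofReal (Real.exp m)
      ≤ ∫⁻ a, ENNReal.ofReal (Real.exp m * (f a + (1 - m))) ∂μ := by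
        conv_lhs => rw [← hgi]
        exact ofReal_integral_le_lintegral_ofReal hg
    _ ≤ _ := by
        refine lintegral_mono fun a => ENNReal.ofReal_le_ofReal ?_
        have h := Real.add_one_le_exp (f a - m)
        calc Real.exp m * (f a + (1 - m)) ≤ Real.exp m * Real.exp (f a - m) := by
              gcongr; linarith
          _ = Real.exp (f a) := by rw [← Real.exp_add]; ring_nf

theorem integrable_sq_gaussianReal (μ : ℝ) (v : ℝ≥0) :
    Integrable (fun z => z ^ 2) (gaussianReal μ v) :=
  (memLp_id_gaussianReal 2).integrable_sq

theorem integrable_id_gaussianReal (μ : ℝ) (v : ℝ≥0) :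
    Integrable (fun z => z) (gaussianReal μ v) :=
  memLp_one_iff_integrable.1 (memLp_id_gaussianReal 1)

theorem integral_sq_gaussianReal (μ : ℝ) (v : ℝ≥0) :
    ∫ z, z ^ 2 ∂gaussianReal μ v = v + μ ^ 2 := by
  have h := variance_eq_sub (memLp_id_gaussianReal (μ := μ) (v := v) 2)
  rw [variance_id_gaussianReal] at h
  simp only [id, Pi.pow_apply, integral_id_gaussianReal] at h
  linarith

/-- Exponential change of measure between two Gaussian laws. -/
theorem lapCW_gaussianReal_eq_tilt {s τ : ℝ≥0} (hs : s ≠ 0) (hτ : τ ≠ 0) (x u v : ℝ) :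
    lapCW (gaussianReal 0 s) u v =
      ENNReal.ofReal (√((τ : ℝ) / s) * Real.exp (x ^ 2 / (2 * τ))) *
        ∫⁻ z, ENNReal.ofReal (Real.exp ((u - x / τ) * z +
          (v - (1 / (2 * s) - 1 / (2 * τ))) * z ^ 2)) ∂gaussianReal x τ := by
  have hs' : (0 : ℝ) < s := by positivity
  have hτ' : (0 : ℝ) < τ := by positivity
  rw [lapCW, gaussianReal_of_var_ne_zero _ hs, gaussianReal_of_var_ne_zero _ hτ,
    lintegral_withDensity_eq_lintegral_mul _ (measurable_gaussianPDF _ _) (by fun_prop),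
    lintegral_withDensity_eq_lintegral_mul _ (measurable_gaussianPDF _ _) (by fun_prop),
    ← lintegral_const_mul' _ _ ENNReal.ofReal_ne_top]
  refine lintegral_congr fun z => ?_
  simp only [Pi.mul_apply, gaussianPDF]
  rw [← ENNReal.ofReal_mul (gaussianPDFReal_nonneg _ _ _),
    ← ENNReal.ofReal_mul (gaussianPDFReal_nonneg _ _ _), ← ENNReal.ofReal_mul (by positivity)]
  congr 1
  simp only [gaussianPDFReal]
  have h1 : (√(2 * Real.pi * s))⁻¹ = √((τ : ℝ) / s) * (√(2 * Real.pi * τ))⁻¹ := by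
    rw [← Real.sqrt_inv, ← Real.sqrt_inv, ← Real.sqrt_mul (by positivity)]
    congr 1
    field_simp
  have h2 : Real.exp (-(z - 0) ^ 2 / (2 * s)) * Real.exp (u * z + v * z ^ 2) =
      Real.exp (x ^ 2 / (2 * τ)) * (Real.exp (-(z - x) ^ 2 / (2 * τ)) *
        Real.exp ((u - x / τ) * z + (v - (1 / (2 * s) - 1 / (2 * τ))) * z ^ 2)) := by
    rw [← Real.exp_add, ← Real.exp_add, ← Real.exp_add]
    congr 1
    field_simp
    ring
  rw [h1, mul_assoc, h2]
  ring

theorem cramCW_gaussianReal_of_sq_lt {s : ℝ≥0} (hs : s ≠ 0) {x y : ℝ} (hxy : x ^ 2 < y) :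
    cramCW (gaussianReal 0 s) x y =
      (((1 / 2) * (y / (s : ℝ) - 1 - Real.log ((y - x ^ 2) / (s : ℝ))) : ℝ) : EReal) := by
  have hs' : (0 : ℝ) < s := by positivity
  obtain ⟨τ, hτ⟩ : ∃ τ : ℝ≥0, (τ : ℝ) = y - x ^ 2 := ⟨⟨y - x ^ 2, by linarith⟩, rfl⟩
  have hτ' : (0 : ℝ) < τ := by linarith
  have hτ0 : τ ≠ 0 := by exact_mod_cast hτ'.ne'
  obtain rfl : y = τ + x ^ 2 := by linarith
  rw [← hτ]
  have hlog : ∀ m : ℝ, ENNReal.log (ENNReal.ofReal (√((τ : ℝ) / s) * Real.exp (x ^ 2 / (2 * τ))) *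
      ENNReal.ofReal (Real.exp m)) =
        ((Real.log ((τ : ℝ) / s) / 2 + x ^ 2 / (2 * τ) + m : ℝ) : EReal) := by
    intro m
    rw [← ENNReal.ofReal_mul (by positivity), ENNReal.log_ofReal_of_pos (by positivity),
      Real.log_mul (by positivity) (by positivity), Real.log_mul (by positivity) (by positivity),
      Real.log_exp, Real.log_exp, Real.log_sqrt (by positivity)]
  refine le_antisymm (iSup_le ?_) ?_
  · rintro ⟨u, v⟩
    set a := u - x / τ with ha
    set b := v - (1 / (2 * (s : ℝ)) - 1 / (2 * τ)) with hb
    have hint : Integrable (fun z => a * z + b * z ^ 2) (gaussianReal x τ) :=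
      ((integrable_id_gaussianReal x τ).const_mul a).add
        ((integrable_sq_gaussianReal x τ).const_mul b)
    have hm : ∫ z, a * z + b * z ^ 2 ∂gaussianReal x τ = a * x + b * (τ + x ^ 2) := by
      rw [integral_add ((integrable_id_gaussianReal x τ).const_mul a)
        ((integrable_sq_gaussianReal x τ).const_mul b), integral_const_mul, integral_const_mul,
        integral_id_gaussianReal, integral_sq_gaussianReal]
    have hJ := ofReal_exp_integral_le_lintegral hint
    rw [hm] at hJ
    have hle : ((Real.log ((τ : ℝ) / s) / 2 + x ^ 2 / (2 * τ) + (a * x + b * (τ + x ^ 2)) : ℝ)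
        : EReal) ≤ ENNReal.log (lapCW (gaussianReal 0 s) u v) := by
      rw [← hlog, lapCW_gaussianReal_eq_tilt hs hτ0 x u v]
      gcongr
    refine (EReal.sub_le_sub le_rfl hle).trans ?_
    rw [← EReal.coe_sub, EReal.coe_le_coe_iff]
    apply le_of_eq
    rw [ha, hb]
    field_simp
    ring
  · refine le_iSup_of_le (x / τ, 1 / (2 * (s : ℝ)) - 1 / (2 * τ)) ?_
    rw [lapCW_gaussianReal_eq_tilt hs hτ0 x]
    have h1 : ∫⁻ z, ENNReal.ofReal (Real.exp ((x / τ - x / τ) * z +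
          ((1 / (2 * (s : ℝ)) - 1 / (2 * τ)) - (1 / (2 * (s : ℝ)) - 1 / (2 * τ))) * z ^ 2))
          ∂gaussianReal x τ = ENNReal.ofReal (Real.exp 0) := by
      simp
    simp only [h1]
    rw [hlog, ← EReal.coe_sub, EReal.coe_le_coe_iff]
    apply le_of_eq
    field_simp
    ring

theorem abs_sub_log_one_add_sub_sq_le {w : ℝ} (hw : |w| ≤ 1 / 2) :
    |w - Real.log (1 + w) - w ^ 2 / 2| ≤ 2 * |w| ^ 3 := by
  have h := Real.abs_log_sub_add_sum_range_le (x := -w) (by rw [abs_neg]; linarith) 2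
  rw [abs_neg] at h
  have h3 : |w| ^ (2 + 1) / (1 - |w|) ≤ 2 * |w| ^ 3 := by
    rw [div_le_iff₀ (by linarith)]
    have h4 : 0 ≤ |w| ^ 3 := by positivity
    rw [show 2 + 1 = 3 from rfl]
    nlinarith [mul_le_mul_of_nonneg_left hw h4]
  refine le_trans (le_of_eq ?_) (h.trans h3)
  rw [abs_sub_comm, abs_sub_comm, ← abs_neg]
  congr 1
  simp [Finset.sum_range_succ]
  ring

/-- The two logarithmic remainders of `I - x ^ 2 / (2 * y)`, in the variables
`w = y / s - 1` and `r = x ^ 2 / s`. -/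
theorem abs_log_remainder_sub_le {w r : ℝ} (hw : |w| ≤ 1 / 2) (hr : |r| ≤ 1 / 4) :
    |1 / 2 * (w - Real.log (1 + w - r)) - r / (2 * (1 + w)) - (w ^ 2 + r ^ 2) / 4| ≤
      40 * (|w| + |r|) * ((w ^ 2 + r ^ 2) / 4) := by
  have hw1 : 1 / 2 ≤ 1 + w := by linarith [neg_abs_le w]
  have hw0 : 0 < 1 + w := by linarith
  obtain ⟨t, ht⟩ : ∃ t, t = r / (1 + w) := ⟨_, rfl⟩
  have hrt : r = t * (1 + w) := by rw [ht]; field_simp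
  have htr : |t| ≤ 2 * |r| := by
    rw [hrt, abs_mul, abs_of_pos hw0]
    nlinarith [abs_nonneg t]
  have hlog : Real.log (1 + w - r) = Real.log (1 + w) + Real.log (1 + -t) := by
    rw [← Real.log_mul hw0.ne' (by linarith [le_abs_self t]), hrt]
    congr 1
    ring
  have h1 := abs_sub_log_one_add_sub_sq_le hw
  have h2 := abs_sub_log_one_add_sub_sq_le (w := -t) (by rw [abs_neg]; linarith)
  rw [abs_neg, neg_sq] at h2
  have hrw : r / (2 * (1 + w)) = t / 2 := by rw [ht]; field_simp
  have h3 : |t ^ 2 - r ^ 2| ≤ 6 * |w| * |r| ^ 2 := by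
    have h : t ^ 2 - r ^ 2 = -(w * (t * (t + r))) := by rw [hrt]; ring
    rw [h, abs_neg, abs_mul, abs_mul]
    have h4 : |t + r| ≤ 3 * |r| := (abs_add_le t r).trans (by linarith)
    calc |w| * (|t| * |t + r|) ≤ |w| * ((2 * |r|) * (3 * |r|)) := by gcongr
      _ = 6 * |w| * |r| ^ 2 := by ring
  have h5 : |t| ^ 3 ≤ 8 * |r| ^ 3 :=
    (pow_le_pow_left₀ (abs_nonneg t) htr 3).trans_eq (by ring)
  have hsum : |1 / 2 * (w - Real.log (1 + w - r)) - r / (2 * (1 + w)) - (w ^ 2 + r ^ 2) / 4| ≤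
      |w| ^ 3 + 8 * |r| ^ 3 + 2 * (|w| * |r| ^ 2) := by
    rw [hlog, hrw, abs_le]
    rw [abs_le] at h1 h2 h3
    have hw3 : 0 ≤ |w| * |r| ^ 2 := by positivity
    constructor <;> linarith [h1.1, h1.2, h2.1, h2.2, h3.1, h3.2]
  refine hsum.trans ?_
  rw [← sq_abs w, ← sq_abs r]
  have := abs_nonneg w
  have := abs_nonneg r
  have e1 : 0 ≤ |w| ^ 3 := by positivity
  have e2 : 0 ≤ |r| ^ 3 := by positivity
  have e3 : 0 ≤ |w| * |r| ^ 2 := by positivity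
  have e4 : 0 ≤ |r| * |w| ^ 2 := by positivity
  linarith

open ProbabilityTheory Filter Topology in
theorem cramCW_gaussian (σ2 : ℝ≥0) (hσ2 : σ2 ≠ 0) :
    (∀ x y : ℝ, x ^ 2 < y →
      cramCW (gaussianReal 0 σ2) x y =
        (((1 / 2) * (y / (σ2 : ℝ) - 1 - Real.log ((y - x ^ 2) / (σ2 : ℝ))) : ℝ) : EReal)) ∧
    Tendsto
      (fun p : ℝ × ℝ =>
        ((cramCW (gaussianReal 0 σ2) p.1 p.2).toReal - p.1 ^ 2 / (2 * p.2)) /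
          (p.1 ^ 4 / (4 * (σ2 : ℝ) ^ 2) + (p.2 - (σ2 : ℝ)) ^ 2 / (4 * (σ2 : ℝ) ^ 2)))
      (𝓝[{((0 : ℝ), ((σ2 : ℝ) : ℝ))}ᶜ] (0, (σ2 : ℝ))) (𝓝 1) := by
  refine ⟨fun x y hxy => cramCW_gaussianReal_of_sq_lt hσ2 hxy, ?_⟩
  have hs : (0 : ℝ) < σ2 := by positivity
  have hw : Tendsto (fun p : ℝ × ℝ => |p.2 / (σ2 : ℝ) - 1|)
      (𝓝[{((0 : ℝ), (σ2 : ℝ))}ᶜ] (0, (σ2 : ℝ))) (𝓝 0) := by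
    have h : Continuous fun p : ℝ × ℝ => |p.2 / (σ2 : ℝ) - 1| := by fun_prop
    simpa [hs.ne'] using (h.tendsto (0, (σ2 : ℝ))).mono_left nhdsWithin_le_nhds
  have hr : Tendsto (fun p : ℝ × ℝ => |p.1 ^ 2 / (σ2 : ℝ)|)
      (𝓝[{((0 : ℝ), (σ2 : ℝ))}ᶜ] (0, (σ2 : ℝ))) (𝓝 0) := by
    have h : Continuous fun p : ℝ × ℝ => |p.1 ^ 2 / (σ2 : ℝ)| := by fun_prop
    simpa using (h.tendsto (0, (σ2 : ℝ))).mono_left nhdsWithin_le_nhds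
  have hb : Tendsto (fun p : ℝ × ℝ => 40 * (|p.2 / (σ2 : ℝ) - 1| + |p.1 ^ 2 / (σ2 : ℝ)|))
      (𝓝[{((0 : ℝ), (σ2 : ℝ))}ᶜ] (0, (σ2 : ℝ))) (𝓝 0) := by
    simpa using (hw.add hr).const_mul 40
  rw [tendsto_iff_norm_sub_tendsto_zero]
  refine squeeze_zero' (Eventually.of_forall fun _ => norm_nonneg _) ?_ hb
  filter_upwards [hw.eventually_le_const (show (0 : ℝ) < 1 / 2 by norm_num),
    hr.eventually_le_const (show (0 : ℝ) < 1 / 4 by norm_num), self_mem_nhdsWithin]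
    with ⟨x, y⟩ hw hr hne
  dsimp only at hw hr ⊢
  obtain ⟨w, hwy⟩ : ∃ w, w = y / (σ2 : ℝ) - 1 := ⟨_, rfl⟩
  obtain ⟨r, hrx⟩ : ∃ r, r = x ^ 2 / (σ2 : ℝ) := ⟨_, rfl⟩
  have hy : y = σ2 * (1 + w) := by rw [hwy]; field_simp; ring
  have hx : x ^ 2 = σ2 * r := by rw [hrx]; field_simp
  rw [← hwy] at hw ⊢
  rw [← hrx] at hr ⊢
  have hw1 : 0 < 1 + w := by linarith [neg_abs_le w]
  have hxy : x ^ 2 < y := by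
    rw [hx, hy]
    gcongr
    linarith [neg_abs_le w, le_abs_self r]
  have hD : x ^ 4 / (4 * (σ2 : ℝ) ^ 2) + (y - σ2) ^ 2 / (4 * (σ2 : ℝ) ^ 2) =
      (w ^ 2 + r ^ 2) / 4 := by
    rw [show x ^ 4 = (x ^ 2) ^ 2 by ring, hx, hy]
    field_simp
    ring
  have hDpos : 0 < (w ^ 2 + r ^ 2) / 4 := by
    have h0 : w ≠ 0 ∨ r ≠ 0 := by
      by_contra! h
      apply hne
      rw [h.1] at hy
      rw [h.2] at hx
      have hx0 : x = 0 := by simpa using hx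
      simp [hx0, hy]
    rcases h0 with h0 | h0 <;> positivity
  have hN : (cramCW (gaussianReal 0 σ2) x y).toReal - x ^ 2 / (2 * y) =
      1 / 2 * (w - Real.log (1 + w - r)) - r / (2 * (1 + w)) := by
    rw [cramCW_gaussianReal_of_sq_lt hσ2 hxy, EReal.toReal_coe, ← hwy]
    have h1 : (y - x ^ 2) / (σ2 : ℝ) = 1 + w - r := by rw [hx, hy]; field_simp
    have h2 : x ^ 2 / (2 * y) = r / (2 * (1 + w)) := by rw [hx, hy]; field_simp
    rw [h1, h2]
  rw [hN, hD, Real.norm_eq_abs, div_sub_one hDpos.ne', abs_div, abs_of_pos hDpos,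
    div_le_iff₀ hDpos]
  exact abs_log_remainder_sub_le hw hr
end

section
/- Let ρ be a symmetric probability measure on ℝ whose support contains at least three points and such that (0,0) lies in the interior of the domain of Λ(u,v) = ln ∫ e^{uz+vz²} dρ(z). Let σ² be the variance and μ₄ the fourth moment of ρ. Then as (x,y) → (0, σ²), I(x,y) − x²/(2y) ~ (y − σ²)²/(2(μ₄ − σ⁴)) + μ₄ x⁴/(12 σ⁸), where I is the Cramér transform of the law of (Z, Z²), Z ~ ρ. -/
open MeasureTheory ENNReal

/-- The topological support of a measure on `ℝ`. -/
def msupport (ρ : Measure ℝ) : Set ℝ := {x | ∀ U ∈ nhds x, ρ U ≠ 0}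

namespace CramCW

theorem abs_exp_sub_taylor_le (q : ℝ) (n : ℕ) :
    |Real.exp q - ∑ m ∈ Finset.range n, q ^ m / (m.factorial : ℝ)| ≤ |q| ^ n * Real.exp |q| := by
  have h := Complex.norm_exp_sub_sum_le_norm_mul_exp (q : ℂ) n
  rw [Complex.norm_real, Real.norm_eq_abs] at h
  rw [← Real.norm_eq_abs, ← Complex.norm_real]
  push_cast
  exact h

theorem abs_exp_sub_quadratic_le (q : ℝ) :
    |Real.exp q - (1 + q + q ^ 2 / 2)| ≤ |q| ^ 3 * Real.exp |q| := by
  have h := abs_exp_sub_taylor_le q 3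
  norm_num [Finset.sum_range_succ, Nat.factorial] at h
  exact h

theorem abs_cosh_sub_quartic_le (w : ℝ) :
    |Real.cosh w - (1 + w ^ 2 / 2 + w ^ 4 / 24)| ≤ w ^ 6 * Real.exp |w| := by
  have h1 := abs_exp_sub_taylor_le w 6
  have h2 := abs_exp_sub_taylor_le (-w) 6
  rw [abs_neg] at h2
  have hw : |w| ^ 6 = w ^ 6 := by
    rw [show 6 = 2 * 3 by norm_num, pow_mul, pow_mul, sq_abs]
  rw [hw] at h1 h2
  norm_num [Finset.sum_range_succ, Nat.factorial] at h1 h2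
  rw [Real.cosh_eq]
  rw [abs_le] at *
  constructor <;> nlinarith

theorem abs_cosh_mul_exp_sub_le {w q S : ℝ} (hw : w ^ 2 ≤ S) (hq : |q| ≤ S) :
    |Real.cosh w * Real.exp q
        - (1 + w ^ 2 / 2 + q + w ^ 4 / 24 + q ^ 2 / 2 + w ^ 2 * q / 2)|
      ≤ 10 * S ^ 3 * Real.exp S ^ 2 := by
  have hS : 0 ≤ S := (sq_nonneg w).trans hw
  have hE : 1 + S + S ^ 2 / 2 ≤ Real.exp S := Real.quadratic_le_exp_of_nonneg hS
  have h1 : |Real.cosh w - (1 + w ^ 2 / 2 + w ^ 4 / 24)| ≤ S ^ 3 * (3 * Real.exp S) := by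
    refine (abs_cosh_sub_quartic_le w).trans ?_
    have hw6 : w ^ 6 ≤ S ^ 3 := by
      calc w ^ 6 = (w ^ 2) ^ 3 := by ring
        _ ≤ S ^ 3 := by gcongr
    have he : Real.exp |w| ≤ 3 * Real.exp S := by
      have : |w| ≤ 1 + S := by nlinarith [sq_abs w, abs_nonneg w, sq_nonneg (|w| - 1)]
      calc Real.exp |w| ≤ Real.exp (1 + S) := Real.exp_le_exp.2 this
        _ = Real.exp 1 * Real.exp S := Real.exp_add _ _
        _ ≤ 3 * Real.exp S := by
          have := Real.exp_one_lt_d9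
          gcongr
          linarith
    gcongr
  have h2 : |Real.exp q - (1 + q + q ^ 2 / 2)| ≤ S ^ 3 * Real.exp S := by
    refine (abs_exp_sub_quadratic_le q).trans ?_
    gcongr
  have hqE : |Real.exp q| ≤ Real.exp S := by
    rw [Real.abs_exp]
    exact Real.exp_le_exp.2 ((le_abs_self q).trans hq)
  have hw4 : w ^ 4 ≤ S ^ 2 := by
    calc w ^ 4 = (w ^ 2) ^ 2 := by ring
      _ ≤ S ^ 2 := by gcongr
  have hq2 : q ^ 2 ≤ S ^ 2 := by
    rw [← sq_abs]; gcongr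
  have hc : |1 + w ^ 2 / 2 + w ^ 4 / 24| ≤ Real.exp S := by
    rw [abs_of_nonneg (by positivity)]
    nlinarith [sq_nonneg S]
  have key : Real.cosh w * Real.exp q
        - (1 + w ^ 2 / 2 + q + w ^ 4 / 24 + q ^ 2 / 2 + w ^ 2 * q / 2)
      = (Real.cosh w - (1 + w ^ 2 / 2 + w ^ 4 / 24)) * Real.exp q
        + (1 + w ^ 2 / 2 + w ^ 4 / 24) * (Real.exp q - (1 + q + q ^ 2 / 2))
        + (w ^ 2 * q ^ 2 / 4 + w ^ 4 * q / 24 + w ^ 4 * q ^ 2 / 48) := by ring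
  have hE1 : 1 ≤ Real.exp S := by nlinarith [sq_nonneg S]
  have b1 : |w ^ 2 * q ^ 2 / 4 + w ^ 4 * q / 24 + w ^ 4 * q ^ 2 / 48| ≤ S ^ 3 * Real.exp S := by
    have e1 : |w ^ 2 * q ^ 2 / 4| ≤ S ^ 3 / 4 := by
      rw [abs_of_nonneg (by positivity)]
      calc w ^ 2 * q ^ 2 / 4 ≤ S * S ^ 2 / 4 := by gcongr
        _ = _ := by ring
    have e2 : |w ^ 4 * q / 24| ≤ S ^ 3 / 24 := by
      rw [abs_div, abs_mul, abs_of_nonneg (by positivity : 0 ≤ w ^ 4),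
        abs_of_nonneg (by norm_num : (0 : ℝ) ≤ 24)]
      calc w ^ 4 * |q| / 24 ≤ S ^ 2 * S / 24 := by gcongr
        _ = _ := by ring
    have e3 : |w ^ 4 * q ^ 2 / 48| ≤ S ^ 4 / 48 := by
      rw [abs_of_nonneg (by positivity)]
      calc w ^ 4 * q ^ 2 / 48 ≤ S ^ 2 * S ^ 2 / 48 := by gcongr
        _ = _ := by ring
    have e4 : S ^ 3 * (1 + S) ≤ S ^ 3 * Real.exp S := by
      gcongr; nlinarith [sq_nonneg S]
    have hS3 : 0 ≤ S ^ 3 := by positivity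
    have hS4 : 0 ≤ S ^ 4 := by positivity
    calc _ ≤ _ := abs_add_three _ _ _
      _ ≤ S ^ 3 * (1 + S) := by nlinarith
      _ ≤ _ := e4
  rw [key]
  calc _ ≤ _ := abs_add_three _ _ _
    _ ≤ S ^ 3 * (3 * Real.exp S) * Real.exp S + Real.exp S * (S ^ 3 * Real.exp S)
        + S ^ 3 * Real.exp S := by
      rw [abs_mul, abs_mul]
      gcongr
    _ ≤ 10 * S ^ 3 * Real.exp S ^ 2 := by
      have : 0 ≤ S ^ 3 * Real.exp S := by positivity
      nlinarith

theorem cube_le_exp {t : ℝ} (ht : 0 ≤ t) : t ^ 3 ≤ 6 * Real.exp t := by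
  have := Real.sum_le_exp_of_nonneg ht 4
  norm_num [Finset.sum_range_succ, Nat.factorial] at this
  nlinarith [sq_nonneg t]

theorem abs_cosh_mul_exp_sub_le_scaled {u v z s₀ : ℝ} (hs₀ : 0 < s₀)
    (hs : u ^ 2 + |v| ≤ s₀) :
    |Real.cosh (u * z) * Real.exp (v * z ^ 2)
        - (1 + (u ^ 2 / 2 + v) * z ^ 2 + (u ^ 4 / 24 + v ^ 2 / 2 + u ^ 2 * v / 2) * z ^ 4)|
      ≤ 60 / s₀ ^ 3 * (u ^ 2 + |v|) ^ 3 * Real.exp (3 * s₀ * z ^ 2) := by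
  set s := u ^ 2 + |v| with hsdef
  have hs0 : 0 ≤ s := by positivity
  have hz : 0 ≤ z ^ 2 := sq_nonneg z
  have h := abs_cosh_mul_exp_sub_le (w := u * z) (q := v * z ^ 2) (S := s * z ^ 2)
    (by rw [mul_pow]; gcongr; rw [hsdef]; linarith [abs_nonneg v])
    (by rw [abs_mul, abs_of_nonneg hz]; gcongr; rw [hsdef]; nlinarith [sq_nonneg u])
  calc _ = _ := by congr 1; ring
    _ ≤ _ := h
    _ = 10 / s₀ ^ 3 * s ^ 3 * ((s₀ * z ^ 2) ^ 3 * Real.exp (s * z ^ 2) ^ 2) := by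
      field_simp
    _ ≤ 10 / s₀ ^ 3 * s ^ 3 * ((6 * Real.exp (s₀ * z ^ 2)) * Real.exp (s₀ * z ^ 2) ^ 2) := by
      gcongr
      exact cube_le_exp (by positivity)
    _ = _ := by
      rw [show 3 * s₀ * z ^ 2 = s₀ * z ^ 2 + s₀ * z ^ 2 + s₀ * z ^ 2 by ring, Real.exp_add,
        Real.exp_add]
      ring

theorem abs_log_one_add_sub_le {σ μ K s u v m : ℝ} (hσ : 0 ≤ σ) (hμ : 0 ≤ μ) (hK : 0 ≤ K)
    (hs : s = u ^ 2 + |v|) (hs1 : s ≤ 1) (hsC : 2 * (σ + μ + K) * s ≤ 1)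
    (hm : |m - (σ * (u ^ 2 / 2 + v) + μ * (u ^ 4 / 24 + v ^ 2 / 2 + u ^ 2 * v / 2))|
      ≤ K * s ^ 3) :
    |Real.log (1 + m) - (σ * v + σ * u ^ 2 / 2 + (μ - 3 * σ ^ 2) / 24 * u ^ 4
        + (μ - σ ^ 2) / 2 * (v ^ 2 + u ^ 2 * v))|
      ≤ (K + (μ + K) * (σ + μ + K) + 2 * (σ + μ + K) ^ 3) * s ^ 3 := by
  have hs0 : 0 ≤ s := by rw [hs]; positivity
  have hu : u ^ 2 ≤ s := by rw [hs]; linarith [abs_nonneg v]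
  have hv : |v| ≤ s := by rw [hs]; linarith [sq_nonneg u]
  have hv2 : v ^ 2 ≤ s ^ 2 := by rw [← sq_abs]; gcongr
  have hu4 : u ^ 4 ≤ s ^ 2 := by
    calc u ^ 4 = (u ^ 2) ^ 2 := by ring
      _ ≤ _ := by gcongr
  have huv : |u ^ 2 * v| ≤ s ^ 2 / 4 := by
    rw [abs_mul, abs_of_nonneg (sq_nonneg u), hs]
    nlinarith [sq_nonneg (u ^ 2 - |v|)]
  set A := σ * (u ^ 2 / 2 + v) with hA
  set B := μ * (u ^ 4 / 24 + v ^ 2 / 2 + u ^ 2 * v / 2) with hB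
  set C := σ + μ + K with hC
  have hA' : |A| ≤ σ * s := by
    rw [hA, abs_mul, abs_of_nonneg hσ]
    gcongr
    rw [abs_le]; rw [abs_le] at hv
    constructor
    · nlinarith [sq_nonneg u, neg_abs_le v]
    · nlinarith [sq_nonneg u, le_abs_self v]
  have hB' : |B| ≤ μ * s ^ 2 := by
    rw [hB, abs_mul, abs_of_nonneg hμ]
    gcongr
    have : 0 ≤ u ^ 4 := by positivity
    rw [abs_le] at huv ⊢
    constructor <;> nlinarith [sq_nonneg v, sq_nonneg s]
  have hs3 : s ^ 3 ≤ s ^ 2 := pow_le_pow_of_le_one hs0 hs1 (by norm_num)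
  have hs2 : s ^ 2 ≤ s := by nlinarith
  have hmA : |m - A| ≤ (μ + K) * s ^ 2 := by
    calc |m - A| = |(m - (A + B)) + B| := by congr 1; ring
      _ ≤ K * s ^ 3 + μ * s ^ 2 := (abs_add_le _ _).trans (by gcongr)
      _ ≤ _ := by nlinarith
  have hmC : |m| ≤ C * s := by
    calc |m| = |(m - A) + A| := by congr 1; ring
      _ ≤ (μ + K) * s ^ 2 + σ * s := (abs_add_le _ _).trans (by gcongr)
      _ ≤ _ := by rw [hC]; nlinarith
  have hC0 : 0 ≤ C := by positivity
  have hmh : |m| ≤ 1 / 2 := by linarith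
  have hlog := Real.abs_log_sub_add_sum_range_le (x := -m) (by rw [abs_neg]; linarith) 2
  norm_num [Finset.sum_range_succ] at hlog
  have hlog' : |-m + m ^ 2 / 2 + Real.log (1 + m)| ≤ 2 * (C * s) ^ 3 := by
    refine hlog.trans ?_
    rw [div_le_iff₀ (by linarith)]
    have h3 : |m| ^ 3 ≤ (C * s) ^ 3 := by gcongr
    have : 0 ≤ (C * s) ^ 3 := by positivity
    nlinarith
  have hsqd : |(m ^ 2 - A ^ 2) / 2| ≤ (μ + K) * C * s ^ 3 := by
    have hmpA : |m + A| ≤ 2 * (C * s) := by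
      refine (abs_add_le _ _).trans ?_
      have : σ * s ≤ C * s := by gcongr; rw [hC]; linarith
      linarith
    rw [show (m ^ 2 - A ^ 2) / 2 = (m - A) * (m + A) / 2 by ring, abs_div, abs_mul, abs_two]
    calc |m - A| * |m + A| / 2 ≤ ((μ + K) * s ^ 2) * (2 * (C * s)) / 2 := by gcongr
      _ = _ := by ring
  have key : Real.log (1 + m) - (σ * v + σ * u ^ 2 / 2 + (μ - 3 * σ ^ 2) / 24 * u ^ 4
        + (μ - σ ^ 2) / 2 * (v ^ 2 + u ^ 2 * v))
      = (m - (A + B)) + (-((m ^ 2 - A ^ 2) / 2)) + (-m + m ^ 2 / 2 + Real.log (1 + m)) := by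
    rw [hA, hB]; ring
  rw [key]
  calc _ ≤ _ := abs_add_three _ _ _
    _ ≤ K * s ^ 3 + (μ + K) * C * s ^ 3 + 2 * (C * s) ^ 3 := by
      rw [abs_neg]; gcongr
    _ = _ := by ring

theorem lapCW_pos (ρ : Measure ℝ) [IsProbabilityMeasure ρ] (u v : ℝ) : lapCW ρ u v ≠ 0 := by
  intro h
  rw [lapCW, lintegral_eq_zero_iff (by fun_prop)] at h
  have : ∀ᵐ _ ∂ρ, False := by
    filter_upwards [h] with z hz
    simp only [Pi.zero_apply, ENNReal.ofReal_eq_zero] at hz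
    exact absurd (Real.exp_pos _) (not_lt.2 hz)
  simp only [Filter.eventually_false_iff_eq_bot, ae_eq_bot] at this
  exact IsProbabilityMeasure.ne_zero ρ this

theorem integrable_of_lapCW_lt_top {ρ : Measure ℝ} {u v : ℝ} (h : lapCW ρ u v < ⊤) :
    Integrable (fun z => Real.exp (u * z + v * z ^ 2)) ρ := by
  refine ⟨by fun_prop, ?_⟩
  rw [hasFiniteIntegral_iff_ofReal (Filter.Eventually.of_forall fun _ => (Real.exp_pos _).le)]
  exact h

theorem lapCW_eq_ofReal {ρ : Measure ℝ} {u v : ℝ}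
    (h : Integrable (fun z => Real.exp (u * z + v * z ^ 2)) ρ) :
    lapCW ρ u v = ENNReal.ofReal (∫ z, Real.exp (u * z + v * z ^ 2) ∂ρ) :=
  (ofReal_integral_eq_lintegral_ofReal h
    (Filter.Eventually.of_forall fun _ => (Real.exp_pos _).le)).symm

theorem integrable_sq_of_exp {ρ : Measure ℝ} {c : ℝ} (hc : 0 < c)
    (h : Integrable (fun z => Real.exp (c * z ^ 2)) ρ) :
    Integrable (fun z => z ^ 2) ρ := by
  refine (h.const_mul (1 / c)).mono' (by fun_prop) (Filter.Eventually.of_forall fun z => ?_)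
  rw [Real.norm_eq_abs, abs_of_nonneg (sq_nonneg z), div_mul_eq_mul_div, le_div_iff₀ hc]
  linarith [Real.add_one_le_exp (c * z ^ 2)]

theorem integrable_pow_four_of_exp {ρ : Measure ℝ} {c : ℝ} (hc : 0 < c)
    (h : Integrable (fun z => Real.exp (c * z ^ 2)) ρ) :
    Integrable (fun z => z ^ 4) ρ := by
  refine (h.const_mul (2 / c ^ 2)).mono' (by fun_prop) (Filter.Eventually.of_forall fun z => ?_)
  rw [Real.norm_eq_abs, abs_of_nonneg (by positivity), div_mul_eq_mul_div,
    le_div_iff₀ (by positivity)]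
  have h0 : 0 ≤ c * z ^ 2 := by positivity
  nlinarith [Real.quadratic_le_exp_of_nonneg h0]

theorem integrable_exp_add_of_le {ρ : Measure ℝ} {u v s₀ : ℝ} (hs₀ : 0 < s₀)
    (h : Integrable (fun z => Real.exp (3 * s₀ * z ^ 2)) ρ) (hs : u ^ 2 + |v| ≤ s₀) :
    Integrable (fun z => Real.exp (u * z + v * z ^ 2)) ρ := by
  refine (h.const_mul (Real.exp 1)).mono' (by fun_prop)
    (Filter.Eventually.of_forall fun z => ?_)
  rw [Real.norm_eq_abs, Real.abs_exp, ← Real.exp_add]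
  refine Real.exp_le_exp.2 ?_
  have h1 : u * z ≤ 1 + u ^ 2 * z ^ 2 := by nlinarith [sq_nonneg (u * z - 1), sq_nonneg (u * z)]
  have h2 : v * z ^ 2 ≤ |v| * z ^ 2 := by gcongr; exact le_abs_self v
  have h3 : (u ^ 2 + |v|) * z ^ 2 ≤ 3 * s₀ * z ^ 2 := by gcongr; linarith
  linarith

theorem integral_exp_eq_integral_cosh {ρ : Measure ℝ} (hsym : ρ.map (fun z => -z) = ρ) {u v : ℝ}
    (h : Integrable (fun z => Real.exp (u * z + v * z ^ 2)) ρ) :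
    Integrable (fun z => Real.cosh (u * z) * Real.exp (v * z ^ 2)) ρ ∧
      ∫ z, Real.exp (u * z + v * z ^ 2) ∂ρ
        = ∫ z, Real.cosh (u * z) * Real.exp (v * z ^ 2) ∂ρ := by
  have hneg : Integrable (fun z => Real.exp (u * -z + v * (-z) ^ 2)) ρ := by
    have h' := h
    rw [← hsym] at h'
    exact h'.comp_measurable (by fun_prop)
  have heq : ∫ z, Real.exp (u * -z + v * (-z) ^ 2) ∂ρ
      = ∫ z, Real.exp (u * z + v * z ^ 2) ∂ρ := by
    conv_rhs => rw [← hsym]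
    rw [integral_map (by fun_prop) (by fun_prop)]
  have hfun : (fun z => Real.cosh (u * z) * Real.exp (v * z ^ 2))
      = fun z => (Real.exp (u * z + v * z ^ 2) + Real.exp (u * -z + v * (-z) ^ 2)) / 2 := by
    funext z
    rw [Real.cosh_eq, Real.exp_add, Real.exp_add, neg_sq, mul_neg]
    ring
  rw [hfun]
  refine ⟨(h.add hneg).div_const 2, ?_⟩
  rw [integral_div, integral_add h hneg, heq]
  ring

theorem exists_log_lapCW_expansion {ρ : Measure ℝ} [IsProbabilityMeasure ρ]
    (hsym : ρ.map (fun z => -z) = ρ) {c : ℝ} (hc : 0 < c)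
    (hint : Integrable (fun z => Real.exp (c * z ^ 2)) ρ)
    {σ μ : ℝ} (hσ : ∫ z, z ^ 2 ∂ρ = σ) (hμ : ∫ z, z ^ 4 ∂ρ = μ) :
    ∃ K > 0, ∃ s₁ > 0, ∀ u v : ℝ, u ^ 2 + |v| ≤ s₁ → lapCW ρ u v ≠ ⊤ ∧
      |Real.log (lapCW ρ u v).toReal - (σ * v + σ * u ^ 2 / 2 + (μ - 3 * σ ^ 2) / 24 * u ^ 4
        + (μ - σ ^ 2) / 2 * (v ^ 2 + u ^ 2 * v))| ≤ K * (u ^ 2 + |v|) ^ 3 := by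
  obtain ⟨s₀, hs₀, rfl⟩ : ∃ s₀ : ℝ, 0 < s₀ ∧ c = 3 * s₀ := ⟨c / 3, by positivity, by ring⟩
  have hσ0 : 0 ≤ σ := hσ ▸ integral_nonneg fun z => sq_nonneg z
  have hμ0 : 0 ≤ μ := hμ ▸ integral_nonneg fun z => by positivity
  have hi2 := integrable_sq_of_exp hc hint
  have hi4 := integrable_pow_four_of_exp hc hint
  set G := ∫ z, Real.exp (3 * s₀ * z ^ 2) ∂ρ with hG
  have hG0 : 0 ≤ G := integral_nonneg fun z => (Real.exp_pos _).le
  set K := 60 / s₀ ^ 3 * G with hK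
  have hK0 : 0 ≤ K := by positivity
  refine ⟨K + (μ + K) * (σ + μ + K) + 2 * (σ + μ + K) ^ 3 + 1, by positivity,
    min s₀ (min 1 (1 / (2 * (σ + μ + K) + 1))), by positivity, fun u v huv => ?_⟩
  simp only [le_min_iff] at huv
  obtain ⟨hus, hu1, huC⟩ := huv
  have hexp := integrable_exp_add_of_le hs₀ hint hus
  obtain ⟨hcosh, heq⟩ := integral_exp_eq_integral_cosh hsym hexp
  have hlap := lapCW_eq_ofReal hexp
  refine ⟨by rw [hlap]; exact ENNReal.ofReal_ne_top, ?_⟩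
  have hs0 : 0 ≤ u ^ 2 + |v| := by positivity
  have hquad : Integrable (fun z => 1 + (u ^ 2 / 2 + v) * z ^ 2) ρ :=
    (integrable_const _).add (hi2.const_mul _)
  have hpoly : Integrable (fun z => 1 + (u ^ 2 / 2 + v) * z ^ 2
      + (u ^ 4 / 24 + v ^ 2 / 2 + u ^ 2 * v / 2) * z ^ 4) ρ :=
    hquad.add (hi4.const_mul _)
  have hpolyint : ∫ z, (1 + (u ^ 2 / 2 + v) * z ^ 2
      + (u ^ 4 / 24 + v ^ 2 / 2 + u ^ 2 * v / 2) * z ^ 4) ∂ρ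
      = 1 + (σ * (u ^ 2 / 2 + v) + μ * (u ^ 4 / 24 + v ^ 2 / 2 + u ^ 2 * v / 2)) := by
    rw [integral_add hquad (hi4.const_mul _),
      integral_add (integrable_const _) (hi2.const_mul _), integral_const_mul,
      integral_const_mul, hσ, hμ]
    simp
    ring
  have hbound : |∫ z, Real.cosh (u * z) * Real.exp (v * z ^ 2) ∂ρ
      - (1 + (σ * (u ^ 2 / 2 + v) + μ * (u ^ 4 / 24 + v ^ 2 / 2 + u ^ 2 * v / 2)))|
      ≤ K * (u ^ 2 + |v|) ^ 3 := by
    rw [← hpolyint, ← integral_sub hcosh hpoly, ← Real.norm_eq_abs]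
    refine (norm_integral_le_of_norm_le
      (hint.const_mul (60 / s₀ ^ 3 * (u ^ 2 + |v|) ^ 3))
      (Filter.Eventually.of_forall fun z => abs_cosh_mul_exp_sub_le_scaled hs₀ hus)).trans ?_
    rw [integral_const_mul, ← hG, hK]
    apply le_of_eq
    ring
  set m := ∫ z, Real.cosh (u * z) * Real.exp (v * z ^ 2) ∂ρ - 1 with hm
  have hlapm : (lapCW ρ u v).toReal = 1 + m := by
    rw [hlap, ENNReal.toReal_ofReal (integral_nonneg fun z => (Real.exp_pos _).le), heq, hm]
    ring
  rw [hlapm]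
  refine (abs_log_one_add_sub_le hσ0 hμ0 hK0 rfl hu1 ?_ ?_).trans ?_
  · have : 0 < 2 * (σ + μ + K) + 1 := by positivity
    rw [le_div_iff₀ this] at huC
    linarith
  · rw [hm, sub_sub]
    exact hbound
  · exact mul_le_mul_of_nonneg_right (by linarith) (by positivity)

theorem lapCW_mul_le_rpow (ρ : Measure ℝ) [IsProbabilityMeasure ρ] {t : ℝ} (ht : 0 < t)
    (ht1 : t ≤ 1) (u v : ℝ) : lapCW ρ (t * u) (t * v) ≤ lapCW ρ u v ^ t := by
  have h := eLpNorm'_le_eLpNorm'_of_exponent_le (f := fun z => Real.exp (u * z + v * z ^ 2))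
    ht ht1 ρ (by fun_prop)
  simp only [eLpNorm', Real.enorm_of_nonneg (Real.exp_pos _).le, ENNReal.rpow_one, one_div,
    inv_one] at h
  have h' := ENNReal.rpow_le_rpow h ht.le
  rw [ENNReal.rpow_inv_rpow ht.ne'] at h'
  change _ ≤ (∫⁻ z, ENNReal.ofReal (Real.exp (u * z + v * z ^ 2)) ∂ρ) ^ t
  convert h' using 1
  refine lintegral_congr fun z => ?_
  rw [ENNReal.ofReal_rpow_of_pos (Real.exp_pos _), ← Real.exp_mul]
  congr 2
  ring

theorem moments_of_three_support_points {ρ : Measure ℝ} [IsProbabilityMeasure ρ]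
    (hsupp : ∃ a b c : ℝ, a ∈ msupport ρ ∧ b ∈ msupport ρ ∧ c ∈ msupport ρ ∧
      a ≠ b ∧ b ≠ c ∧ a ≠ c)
    (hi2 : Integrable (fun z => z ^ 2) ρ) (hi4 : Integrable (fun z => z ^ 4) ρ)
    {σ μ : ℝ} (hσ : ∫ z, z ^ 2 ∂ρ = σ) (hμ : ∫ z, z ^ 4 ∂ρ = μ) :
    0 < σ ∧ σ ^ 2 < μ := by
  have hne (d : ℝ) (h : ∀ᵐ z ∂ρ, z ^ 2 = d) : False := by
    have hmem (a : ℝ) (ha : a ∈ msupport ρ) : a ^ 2 = d := by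
      by_contra hcon
      refine ha {z | z ^ 2 ≠ d} ?_ h
      exact (isOpen_ne_fun (by fun_prop) (by fun_prop)).mem_nhds hcon
    obtain ⟨a, b, c, ha, hb, hc, hab, hbc, hac⟩ := hsupp
    have hb' : a = b ∨ a = -b := sq_eq_sq_iff_eq_or_eq_neg.1 ((hmem a ha).trans (hmem b hb).symm)
    have hc' : a = c ∨ a = -c := sq_eq_sq_iff_eq_or_eq_neg.1 ((hmem a ha).trans (hmem c hc).symm)
    grind
  have hσ0 : 0 ≤ σ := hσ ▸ integral_nonneg fun z => sq_nonneg z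
  constructor
  · refine lt_of_le_of_ne hσ0 fun h => hne 0 ?_
    rw [← h] at hσ
    exact (integral_eq_zero_iff_of_nonneg (fun z => sq_nonneg z) hi2).1 hσ
  · have hfun : (fun z : ℝ => (z ^ 2 - σ) ^ 2) = fun z => z ^ 4 - 2 * σ * z ^ 2 + σ ^ 2 := by
      funext z; ring
    have hsub : Integrable (fun z : ℝ => z ^ 4 - 2 * σ * z ^ 2) ρ := hi4.sub (hi2.const_mul _)
    have hi : Integrable (fun z : ℝ => (z ^ 2 - σ) ^ 2) ρ := by
      rw [hfun]
      exact hsub.add (integrable_const _)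
    have hval : ∫ z, (z ^ 2 - σ) ^ 2 ∂ρ = μ - σ ^ 2 := by
      rw [hfun, integral_add hsub (integrable_const _),
        integral_sub hi4 (hi2.const_mul _), integral_const_mul, hσ, hμ]
      simp
      ring
    have h0 : 0 ≤ μ - σ ^ 2 := hval ▸ integral_nonneg fun z => sq_nonneg _
    refine lt_of_le_of_ne (by linarith) fun h => hne σ ?_
    rw [← h, sub_self] at hval
    filter_upwards [(integral_eq_zero_iff_of_nonneg (fun z => sq_nonneg _) hi).1 hval] with z hz
    have : z ^ 2 - σ = 0 := by simpa using hz
    linarith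

/-- The terms of weighted degree at most four, with `u` of weight one and `v` of weight two, in the
expansion at the origin of the logarithm of the Laplace transform of `(Z, Z ^ 2 - σ)`. -/
noncomputable def quarticPart (σ μ u v : ℝ) : ℝ :=
  σ * u ^ 2 / 2 + (μ - 3 * σ ^ 2) / 24 * u ^ 4 + (μ - σ ^ 2) / 2 * (v ^ 2 + u ^ 2 * v)

/-- The terms of weighted degree at most four in the expansion of the Cramér transform at
`(σ * a, σ + h)`, with `a` of weight one and `h` of weight two. -/
noncomputable def dualQuarticPart (σ μ a h : ℝ) : ℝ :=
  σ * a ^ 2 / 2 - h * a ^ 2 / 2 + h ^ 2 / (2 * (μ - σ ^ 2)) + μ / 12 * a ^ 4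

theorem linear_sub_quadratic_le {D ε η : ℝ} (hD : 0 < D) (hη : 0 ≤ η) (hηD : η ≤ D / 4)
    (h1 : 4 * η ≤ ε * D ^ 2) (h2 : 2 * η ≤ ε) (κ u v h : ℝ) :
    h * v - κ * u ^ 4 - D / 2 * (v ^ 2 + u ^ 2 * v) + η * (u ^ 4 + v ^ 2)
      ≤ h ^ 2 / (2 * D) - h * u ^ 2 / 2 + (D / 8 - κ) * u ^ 4 + ε * (h ^ 2 + u ^ 4) := by
  set g := h - D * u ^ 2 / 2 with hg
  have hD2 : 0 < D - 2 * η := by linarith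
  have e1 : g * v - (D / 2 - η) * v ^ 2 ≤ g ^ 2 / (2 * (D - 2 * η)) := by
    rw [le_div_iff₀ (by positivity)]
    nlinarith [sq_nonneg (g - (D - 2 * η) * v)]
  have e2 : g ^ 2 / (2 * (D - 2 * η)) ≤ g ^ 2 / (2 * D) + 2 * η / D ^ 2 * g ^ 2 := by
    have : 1 / (2 * (D - 2 * η)) ≤ 1 / (2 * D) + 2 * η / D ^ 2 := by
      rw [show 1 / (2 * D) + 2 * η / D ^ 2 = (D + 4 * η) / (2 * D ^ 2) by field_simp; ring,
        div_le_div_iff₀ (by positivity) (by positivity)]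
      nlinarith [mul_nonneg hη (by linarith : 0 ≤ D - 4 * η)]
    have := mul_le_mul_of_nonneg_right this (sq_nonneg g)
    calc _ = 1 / (2 * (D - 2 * η)) * g ^ 2 := by ring
      _ ≤ _ := this
      _ = _ := by ring
  have e3 : g ^ 2 ≤ 2 * h ^ 2 + D ^ 2 * u ^ 4 / 2 := by
    rw [hg]
    nlinarith [sq_nonneg (h + D * u ^ 2 / 2)]
  have e4 : 2 * η / D ^ 2 * g ^ 2 ≤ ε * h ^ 2 + η * u ^ 4 := by
    calc 2 * η / D ^ 2 * g ^ 2 ≤ 2 * η / D ^ 2 * (2 * h ^ 2 + D ^ 2 * u ^ 4 / 2) := by gcongr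
      _ = 4 * η / D ^ 2 * h ^ 2 + η * u ^ 4 := by field_simp; ring
      _ ≤ _ := by
        gcongr
        rw [div_le_iff₀ (by positivity)]
        exact h1
  have e5 : g ^ 2 / (2 * D) = h ^ 2 / (2 * D) - h * u ^ 2 / 2 + D / 8 * u ^ 4 := by
    rw [hg]; field_simp; ring
  have e6 : 2 * η * u ^ 4 ≤ ε * u ^ 4 := mul_le_mul_of_nonneg_right h2 (by positivity)
  have e7 : g * v = h * v - D * u ^ 2 * v / 2 := by rw [hg]; ring
  linarith

theorem add_pow_four_le {t : ℝ} (ht : 0 < t) (a w : ℝ) :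
    (a + w) ^ 4 ≤ (1 + t) ^ 3 * a ^ 4 + (1 + 1 / t) ^ 3 * w ^ 4 := by
  have hsq (p q : ℝ) : (p + q) ^ 2 ≤ (1 + t) * p ^ 2 + (1 + 1 / t) * q ^ 2 := by
    have : (1 + t) * p ^ 2 + (1 + 1 / t) * q ^ 2 - (p + q) ^ 2 = (t * p - q) ^ 2 / t := by
      field_simp; ring
    have : 0 ≤ (t * p - q) ^ 2 / t := by positivity
    linarith
  calc (a + w) ^ 4 = ((a + w) ^ 2) ^ 2 := by ring
    _ ≤ ((1 + t) * a ^ 2 + (1 + 1 / t) * w ^ 2) ^ 2 := by gcongr; exact hsq a w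
    _ ≤ _ := hsq _ _
    _ = _ := by ring

theorem exists_local_upper_bound {σ μ : ℝ} (hσ : 0 < σ) (hμ : σ ^ 2 < μ) {ε : ℝ} (hε : 0 < ε) :
    ∃ η > 0, ∃ δ > 0, ∀ a h u v : ℝ, |a| ≤ δ → |h| ≤ δ → u ^ 2 ≤ δ →
      σ * a * u + h * v - quarticPart σ μ u v + η * (u ^ 4 + v ^ 2)
        ≤ dualQuarticPart σ μ a h + ε * (h ^ 2 + a ^ 4) := by
  have hD : 0 < μ - σ ^ 2 := by linarith
  have hμ0 : 0 < μ := by nlinarith [sq_nonneg σ]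
  obtain ⟨D, hDdef⟩ : ∃ D, D = μ - σ ^ 2 := ⟨_, rfl⟩
  rw [← hDdef] at hD
  obtain ⟨m, hm⟩ : ∃ m, m = μ / 12 + ε / 4 := ⟨_, rfl⟩
  have hm0 : 0 < m := by rw [hm]; positivity
  obtain ⟨t, ht, ht1, htm⟩ : ∃ t : ℝ, 0 < t ∧ t ≤ 1 ∧ 7 * t * m ≤ ε / 4 := by
    refine ⟨min 1 (ε / (28 * m)), by positivity, min_le_left _ _, ?_⟩
    have : min 1 (ε / (28 * m)) ≤ ε / (28 * m) := min_le_right _ _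
    rw [le_div_iff₀ (by positivity)] at this
    linarith
  obtain ⟨C, hC⟩ : ∃ C, C = m * (1 + 1 / t) ^ 3 := ⟨_, rfl⟩
  have hC0 : 0 < C := by rw [hC]; positivity
  obtain ⟨η, hη0, hη1, hη2, hη3⟩ :
      ∃ η > 0, η ≤ D / 4 ∧ η ≤ ε / 4 * D ^ 2 / 4 ∧ η ≤ ε / 8 :=
    ⟨min (D / 4) (min (ε / 4 * D ^ 2 / 4) (ε / 8)), by positivity, min_le_left _ _,
      (min_le_right _ _).trans (min_le_left _ _), (min_le_right _ _).trans (min_le_right _ _)⟩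
  obtain ⟨δ, hδ0, hδ1, hδ2, hδ3, hδ4⟩ :
      ∃ δ > 0, δ ≤ 1 ∧ δ ≤ σ / (32 * C) ∧ δ ≤ ε * σ / 8 ∧ δ ≤ σ / 4 :=
    ⟨min 1 (min (σ / (32 * C)) (min (ε * σ / 8) (σ / 4))), by positivity, min_le_left _ _,
      (min_le_right _ _).trans (min_le_left _ _),
      (min_le_right _ _).trans ((min_le_right _ _).trans (min_le_left _ _)),
      (min_le_right _ _).trans ((min_le_right _ _).trans (min_le_right _ _))⟩
  refine ⟨η, hη0, δ, hδ0, fun a h u v ha hh hu => ?_⟩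
  have hv := linear_sub_quadratic_le hD hη0.le hη1 (by linarith : 4 * η ≤ ε / 4 * D ^ 2)
    (by linarith) ((μ - 3 * σ ^ 2) / 24) u v h
  have hcoef : D / 8 - (μ - 3 * σ ^ 2) / 24 = μ / 12 := by rw [hDdef]; ring
  rw [hcoef] at hv
  obtain ⟨w, rfl⟩ : ∃ w, u = a + w := ⟨u - a, by ring⟩
  have ha2 : a ^ 2 ≤ δ := by
    rw [← sq_abs]
    nlinarith only [abs_nonneg a, ha, hδ1]
  have hw : w ^ 2 ≤ 4 * δ := by nlinarith only [sq_nonneg (a + w + a), ha2, hu]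
  have h4 : m * (a + w) ^ 4 ≤ (m + ε / 4) * a ^ 4 + σ / 8 * w ^ 2 := by
    have hCδ : C * (4 * δ) ≤ σ / 8 := by
      rw [le_div_iff₀ (by positivity)] at hδ2
      linarith
    have hCw : C * w ^ 4 ≤ σ / 8 * w ^ 2 := by
      calc C * w ^ 4 = C * w ^ 2 * w ^ 2 := by ring
        _ ≤ C * (4 * δ) * w ^ 2 := by gcongr
        _ ≤ _ := by gcongr
    have ht3 : m * (1 + t) ^ 3 ≤ m + ε / 4 := by
      have ht2 : t ^ 2 ≤ t := by nlinarith only [ht, ht1]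
      have ht3 : t ^ 3 ≤ t := by nlinarith only [ht, ht1, ht2]
      have : (1 + t) ^ 3 ≤ 1 + 7 * t := by linear_combination 3 * ht2 + ht3
      have := mul_le_mul_of_nonneg_left this hm0.le
      linarith
    calc m * (a + w) ^ 4 ≤ m * ((1 + t) ^ 3 * a ^ 4 + (1 + 1 / t) ^ 3 * w ^ 4) := by
          gcongr; exact add_pow_four_le ht a w
      _ = m * (1 + t) ^ 3 * a ^ 4 + C * w ^ 4 := by rw [hC]; ring
      _ ≤ _ := by gcongr
  have hcross : -(h * a * w) ≤ σ / 8 * w ^ 2 + ε / 4 * h ^ 2 := by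
    have e1 : -(h * a * w) ≤ σ / 8 * w ^ 2 + 2 / σ * (h * a) ^ 2 := by
      have : σ / 8 * w ^ 2 + 2 / σ * (h * a) ^ 2 + h * a * w
          = (σ * w + 4 * (h * a)) ^ 2 / (8 * σ) := by field_simp; ring
      have : 0 ≤ (σ * w + 4 * (h * a)) ^ 2 / (8 * σ) := by positivity
      linarith
    have e2 : 2 / σ * (h * a) ^ 2 ≤ ε / 4 * h ^ 2 := by
      have : 2 / σ * a ^ 2 ≤ ε / 4 := by
        rw [div_mul_eq_mul_div, div_le_iff₀ hσ]
        linarith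
      calc 2 / σ * (h * a) ^ 2 = (2 / σ * a ^ 2) * h ^ 2 := by ring
        _ ≤ _ := by gcongr
    linarith
  have hhw : -(h * w ^ 2 / 2) ≤ σ / 8 * w ^ 2 := by
    have := neg_abs_le h
    nlinarith only [mul_nonneg (by linarith : 0 ≤ σ / 8 + h / 2) (sq_nonneg w)]
  have ha4 : 0 ≤ a ^ 4 := by positivity
  have hh2 := sq_nonneg h
  have hw2 : 0 ≤ σ * w ^ 2 := by positivity
  rw [hm] at h4
  have hεh : 0 ≤ ε * h ^ 2 := by positivity
  have hεa : 0 ≤ ε * a ^ 4 := by positivity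
  unfold quarticPart dualQuarticPart
  rw [← hDdef]
  linarith

theorem add_cube_le {u v r : ℝ} (hs : u ^ 2 + |v| ≤ r) :
    (u ^ 2 + |v|) ^ 3 ≤ 2 * r * (u ^ 4 + v ^ 2) := by
  have h0 : 0 ≤ u ^ 2 + |v| := by positivity
  calc (u ^ 2 + |v|) ^ 3 = (u ^ 2 + |v|) * (u ^ 2 + |v|) ^ 2 := by ring
    _ ≤ r * (2 * (u ^ 4 + v ^ 2)) := by
      refine mul_le_mul hs ?_ (by positivity) (h0.trans hs)
      rw [← sq_abs v]
      nlinarith [sq_nonneg (u ^ 2 - |v|)]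
    _ = _ := by ring

theorem exists_nonpos_on_boundary {σ μ K : ℝ} (hσ : 0 < σ) (hμ : σ ^ 2 < μ) (hK : 0 < K) :
    ∃ r₀ > 0, ∀ r > 0, r ≤ r₀ → ∃ δ > 0, ∀ a h u v : ℝ, |a| ≤ δ → |h| ≤ δ → u ^ 2 + |v| = r →
      σ * a * u + h * v - quarticPart σ μ u v + K * (u ^ 2 + |v|) ^ 3 ≤ 0 := by
  have hD : 0 < μ - σ ^ 2 := by linarith
  obtain ⟨D, hDdef⟩ : ∃ D, D = μ - σ ^ 2 := ⟨_, rfl⟩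
  rw [← hDdef] at hD
  obtain ⟨κ, hκ⟩ : ∃ κ, κ = (μ - 3 * σ ^ 2) / 24 := ⟨_, rfl⟩
  obtain ⟨c, hc0, hcσ, hcD⟩ : ∃ c > 0, 2 * c ≤ σ / 4 ∧ 2 * c ≤ D / 4 :=
    ⟨min σ D / 8, by positivity, by have := min_le_left σ D; linarith,
      by have := min_le_right σ D; linarith⟩
  refine ⟨min 1 (min (σ / 4 / (|κ| + D / 4)) (c / (2 * K))), by positivity,
    fun r hr hr0 => ⟨c * r ^ 2 / (2 * (σ + 1)), by positivity, fun a h u v ha hh hs => ?_⟩⟩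
  simp only [le_min_iff] at hr0
  obtain ⟨hr1, hrκ, hrK⟩ := hr0
  rw [le_div_iff₀ (by positivity)] at hrκ hrK
  have hu2 : u ^ 2 ≤ r := by rw [← hs]; linarith [abs_nonneg v]
  have hv1 : |v| ≤ 1 := by nlinarith only [sq_nonneg u, hs, hr1]
  have hu1 : |u| ≤ 1 := by rw [← sq_le_one_iff_abs_le_one]; linarith
  have hδ : (σ + 1) * (c * r ^ 2 / (2 * (σ + 1))) = c * r ^ 2 / 2 := by field_simp
  generalize c * r ^ 2 / (2 * (σ + 1)) = δ at hδ ha hh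
  have hδ0 : 0 ≤ δ := (abs_nonneg a).trans ha
  have l1 : σ * a * u ≤ σ * δ := by
    calc σ * a * u ≤ |σ * a * u| := le_abs_self _
      _ = σ * |a| * |u| := by rw [abs_mul, abs_mul, abs_of_pos hσ]
      _ ≤ σ * δ * 1 := by gcongr
      _ = _ := by ring
  have l2 : h * v ≤ δ := by
    calc h * v ≤ |h * v| := le_abs_self _
      _ = |h| * |v| := abs_mul _ _
      _ ≤ δ * 1 := by gcongr
      _ = _ := by ring
  have hu4 : (|κ| + D / 4) * u ^ 4 ≤ σ / 4 * u ^ 2 := by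
    calc (|κ| + D / 4) * u ^ 4 = (|κ| + D / 4) * u ^ 2 * u ^ 2 := by ring
      _ ≤ (|κ| + D / 4) * r * u ^ 2 := by gcongr
      _ ≤ _ := by gcongr; linarith
  have hκu : -(|κ| * u ^ 4) ≤ κ * u ^ 4 := by
    have : 0 ≤ u ^ 4 := by positivity
    nlinarith only [neg_abs_le κ, this]
  have hP : σ / 4 * u ^ 2 + D / 4 * v ^ 2 ≤ quarticPart σ μ u v := by
    unfold quarticPart
    rw [← hDdef, ← hκ]
    nlinarith only [mul_nonneg hD.le (sq_nonneg (u ^ 2 + v)), hκu, hu4]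
  have hcr : c * r ^ 2 ≤ σ / 4 * u ^ 2 + D / 4 * v ^ 2 := by
    have hu4' : u ^ 4 ≤ u ^ 2 := by nlinarith only [sq_nonneg u, hu2, hr1]
    have : r ^ 2 ≤ 2 * (u ^ 2 + v ^ 2) := by
      rw [← hs]
      rw [← sq_abs v]
      nlinarith only [sq_nonneg (u ^ 2 - |v|), hu4', sq_nonneg u]
    calc c * r ^ 2 ≤ c * (2 * (u ^ 2 + v ^ 2)) := by gcongr
      _ = 2 * c * u ^ 2 + 2 * c * v ^ 2 := by ring
      _ ≤ _ := by gcongr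
  have hKr : K * r ^ 3 ≤ c * r ^ 2 / 2 := by
    nlinarith only [mul_le_mul_of_nonneg_right hrK (sq_nonneg r)]
  rw [hs]
  linarith

theorem coe_sub_log_lapCW {ρ : Measure ℝ} [IsProbabilityMeasure ρ] {u v : ℝ}
    (h : lapCW ρ u v ≠ ⊤) (c : ℝ) :
    (c : EReal) - ENNReal.log (lapCW ρ u v)
      = ((c - Real.log (lapCW ρ u v).toReal : ℝ) : EReal) := by
  rw [ENNReal.log_pos_real (lapCW_pos ρ u v) h, EReal.coe_sub]

theorem log_lapCW_mul_le {ρ : Measure ℝ} [IsProbabilityMeasure ρ] {t : ℝ} (ht : 0 < t)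
    (ht1 : t ≤ 1) {u v : ℝ} (h : lapCW ρ u v ≠ ⊤) :
    Real.log (lapCW ρ (t * u) (t * v)).toReal ≤ t * Real.log (lapCW ρ u v).toReal := by
  have hle := lapCW_mul_le_rpow ρ ht ht1 u v
  have hfin : lapCW ρ u v ^ t ≠ ⊤ := ENNReal.rpow_ne_top_of_nonneg ht.le h
  have hpos : 0 < (lapCW ρ u v).toReal := ENNReal.toReal_pos (lapCW_pos ρ u v) h
  have hpos' : 0 < (lapCW ρ (t * u) (t * v)).toReal :=
    ENNReal.toReal_pos (lapCW_pos ρ _ _) (ne_top_of_le_ne_top hfin hle)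
  rw [← Real.log_rpow hpos, ENNReal.toReal_rpow]
  exact Real.log_le_log hpos' (ENNReal.toReal_mono hfin hle)

theorem exists_mul_mem_boundary {u v r : ℝ} (hr : 0 < r) (h : r ≤ u ^ 2 + |v|) :
    ∃ t : ℝ, 0 < t ∧ t ≤ 1 ∧ (t * u) ^ 2 + |t * v| = r := by
  have hc : ContinuousOn (fun t : ℝ => (t * u) ^ 2 + |t * v|) (Set.Icc 0 1) := by fun_prop
  obtain ⟨t, ⟨ht0, ht1⟩, ht⟩ := intermediate_value_Icc zero_le_one hc
    (show r ∈ Set.Icc _ _ by simpa using ⟨hr.le, h⟩)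
  refine ⟨t, lt_of_le_of_ne ht0 ?_, ht1, ht⟩
  rintro rfl
  simp at ht
  exact hr.ne ht

/-- The bound on the logarithm of the Laplace transform provided by
`exists_log_lapCW_expansion`. -/
def HasQuarticExpansion (ρ : Measure ℝ) (σ μ K s₁ : ℝ) : Prop :=
  ∀ u v : ℝ, u ^ 2 + |v| ≤ s₁ → lapCW ρ u v ≠ ⊤ ∧
    |Real.log (lapCW ρ u v).toReal - (σ * v + quarticPart σ μ u v)| ≤ K * (u ^ 2 + |v|) ^ 3

theorem exists_cramCW_le {ρ : Measure ℝ} [IsProbabilityMeasure ρ] {σ μ K s₁ : ℝ} (hσ : 0 < σ)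
    (hμ : σ ^ 2 < μ) (hK : 0 < K) (hs₁ : 0 < s₁) (hexp : HasQuarticExpansion ρ σ μ K s₁)
    {ε : ℝ} (hε : 0 < ε) :
    ∃ δ > 0, ∀ a h : ℝ, |a| ≤ δ → |h| ≤ δ →
      cramCW ρ (σ * a) (σ + h)
        ≤ ((dualQuarticPart σ μ a h + ε * (h ^ 2 + a ^ 4) : ℝ) : EReal) := by
  obtain ⟨η, hη, δ₁, hδ₁, hin⟩ := exists_local_upper_bound hσ hμ hε
  obtain ⟨r₀, hr₀, hbd⟩ := exists_nonpos_on_boundary hσ hμ hK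
  obtain ⟨r, hr, hrr₀, hrs₁, hrδ, hrη⟩ :
      ∃ r > 0, r ≤ r₀ ∧ r ≤ s₁ ∧ r ≤ δ₁ ∧ r ≤ η / (2 * K) :=
    ⟨min (min r₀ s₁) (min δ₁ (η / (2 * K))), by positivity,
      (min_le_left _ _).trans (min_le_left _ _), (min_le_left _ _).trans (min_le_right _ _),
      (min_le_right _ _).trans (min_le_left _ _), (min_le_right _ _).trans (min_le_right _ _)⟩
  rw [le_div_iff₀ (by positivity)] at hrη
  obtain ⟨δ₂, hδ₂, hbd⟩ := hbd r hr hrr₀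
  refine ⟨min σ (min δ₁ δ₂), by positivity, fun a h ha hh => ?_⟩
  simp only [le_min_iff] at ha hh
  obtain ⟨-, ha1, ha2⟩ := ha
  obtain ⟨hhσ, hh1, hh2⟩ := hh
  have hD : 0 < μ - σ ^ 2 := by linarith
  have hμ0 : 0 < μ := (sq_nonneg σ).trans_lt hμ
  have hnonneg : 0 ≤ dualQuarticPart σ μ a h + ε * (h ^ 2 + a ^ 4) := by
    have h1 : 0 ≤ (σ - h) * a ^ 2 := mul_nonneg (by linarith [le_abs_self h]) (sq_nonneg a)
    have h2 : 0 ≤ h ^ 2 / (2 * (μ - σ ^ 2)) := by positivity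
    have h3 : 0 ≤ μ / 12 * a ^ 4 := by positivity
    have h4 : 0 ≤ ε * (h ^ 2 + a ^ 4) := by positivity
    unfold dualQuarticPart
    linarith
  refine iSup_le fun ⟨u, v⟩ => ?_
  dsimp only
  by_cases htop : lapCW ρ u v = ⊤
  · rw [htop, ENNReal.log_top, EReal.sub_top]
    exact bot_le
  rw [coe_sub_log_lapCW htop, EReal.coe_le_coe_iff]
  rcases le_total (u ^ 2 + |v|) r with hs | hs
  · have hL := neg_le_of_abs_le (hexp u v (hs.trans hrs₁)).2
    have hcube : K * (u ^ 2 + |v|) ^ 3 ≤ η * (u ^ 4 + v ^ 2) := by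
      calc K * (u ^ 2 + |v|) ^ 3 ≤ K * (2 * r * (u ^ 4 + v ^ 2)) := by
            gcongr; exact add_cube_le hs
        _ = r * (2 * K) * (u ^ 4 + v ^ 2) := by ring
        _ ≤ _ := by gcongr
    have hu : u ^ 2 ≤ δ₁ := by linarith [abs_nonneg v]
    linarith [hin a h u v ha1 hh1 hu]
  · obtain ⟨t, ht, ht1, hts⟩ := exists_mul_mem_boundary hr hs
    have hL := neg_le_of_abs_le (hexp (t * u) (t * v) (hts.le.trans hrs₁)).2
    have hb := hbd a h (t * u) (t * v) ha2 hh2 hts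
    have hmul := log_lapCW_mul_le ht ht1 htop
    refine le_trans ?_ hnonneg
    refine nonpos_of_mul_nonpos_right (a := t) ?_ ht
    linarith

theorem exists_le_cramCW {ρ : Measure ℝ} [IsProbabilityMeasure ρ] {σ μ K s₁ : ℝ}
    (hμ : σ ^ 2 < μ) (hK : 0 < K) (hs₁ : 0 < s₁) (hexp : HasQuarticExpansion ρ σ μ K s₁)
    {ε : ℝ} (hε : 0 < ε) :
    ∃ δ > 0, ∀ a h : ℝ, |a| ≤ δ → |h| ≤ δ →
      ((dualQuarticPart σ μ a h - ε * (h ^ 2 + a ^ 4) : ℝ) : EReal)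
        ≤ cramCW ρ (σ * a) (σ + h) := by
  obtain ⟨D, hDdef⟩ : ∃ D, D = μ - σ ^ 2 := ⟨_, rfl⟩
  have hD : 0 < D := by linarith
  obtain ⟨M, hM⟩ : ∃ M, M = 2 + 1 / D := ⟨_, rfl⟩
  have hM0 : 0 < M := by rw [hM]; positivity
  refine ⟨min 1 (min (s₁ / (2 * M)) (ε / (4 * K * M ^ 3))), by positivity, fun a h ha hh => ?_⟩
  generalize hδ : min 1 (min (s₁ / (2 * M)) (ε / (4 * K * M ^ 3))) = δ at ha hh
  have hδ' := hδ.ge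
  simp only [le_min_iff] at hδ'
  obtain ⟨hδ1, hδs, hδε⟩ := hδ'
  rw [le_div_iff₀ (by positivity)] at hδs hδε
  have hδ0 : 0 ≤ δ := (abs_nonneg a).trans ha
  have ha2 : a ^ 2 ≤ δ := by
    rw [← sq_abs]
    nlinarith only [abs_nonneg a, ha, hδ1]
  obtain ⟨v, hv⟩ : ∃ v, v = (h - D * a ^ 2 / 2) / D := ⟨_, rfl⟩
  have hvabs : |v| ≤ |h| / D + a ^ 2 / 2 := by
    have : v = h / D - a ^ 2 / 2 := by rw [hv]; field_simp
    rw [this]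
    refine (abs_sub _ _).trans ?_
    rw [abs_div, abs_of_pos hD, abs_of_nonneg (by positivity : 0 ≤ a ^ 2 / 2)]
  have hs : a ^ 2 + |v| ≤ M * (a ^ 2 + |h|) := by
    rw [hM]
    have h1 : 0 ≤ a ^ 2 / D := by positivity
    calc a ^ 2 + |v| ≤ a ^ 2 + (|h| / D + a ^ 2 / 2) := by gcongr
      _ ≤ 2 * a ^ 2 + 2 * |h| + a ^ 2 / D + |h| / D := by
        linarith [abs_nonneg h, sq_nonneg a]
      _ = _ := by ring
  have hsδ : a ^ 2 + |h| ≤ 2 * δ := by linarith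
  have hs1 : a ^ 2 + |v| ≤ s₁ := by
    calc _ ≤ _ := hs
      _ ≤ M * (2 * δ) := by gcongr
      _ = δ * (2 * M) := by ring
      _ ≤ _ := hδs
  obtain ⟨htop, hL⟩ := hexp a v hs1
  have hL := le_of_abs_le hL
  have hcube : K * (a ^ 2 + |v|) ^ 3 ≤ ε * (h ^ 2 + a ^ 4) := by
    calc K * (a ^ 2 + |v|) ^ 3 ≤ K * (M * (a ^ 2 + |h|)) ^ 3 := by gcongr
      _ = K * M ^ 3 * (a ^ 2 + |h|) ^ 3 := by ring
      _ ≤ K * M ^ 3 * (2 * (2 * δ) * (a ^ 4 + h ^ 2)) := by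
        gcongr; exact add_cube_le hsδ
      _ = δ * (4 * K * M ^ 3) * (h ^ 2 + a ^ 4) := by ring
      _ ≤ _ := by gcongr
  refine le_trans ?_ (le_iSup _ (a, v))
  dsimp only
  rw [coe_sub_log_lapCW htop, EReal.coe_le_coe_iff]
  have hval : σ * a * a + h * v - quarticPart σ μ a v = dualQuarticPart σ μ a h := by
    unfold quarticPart dualQuarticPart
    rw [← hDdef, hv]
    have : μ = D + σ ^ 2 := by rw [hDdef]; ring
    rw [this]
    field_simp
    ring
  linarith

theorem abs_sq_div_sub_le {σ a h : ℝ} (hσ : 0 < σ) (hh : |h| ≤ σ / 2) :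
    |(σ * a) ^ 2 / (2 * (σ + h)) - (σ * a ^ 2 / 2 - h * a ^ 2 / 2)| ≤ a ^ 2 / σ * h ^ 2 := by
  have hpos : σ / 2 ≤ σ + h := by linarith [neg_abs_le h]
  have hpos' : 0 < σ + h := by linarith
  have : (σ * a) ^ 2 / (2 * (σ + h)) - (σ * a ^ 2 / 2 - h * a ^ 2 / 2)
      = a ^ 2 * h ^ 2 / (2 * (σ + h)) := by field_simp; ring
  rw [this, abs_of_nonneg (by positivity)]
  calc a ^ 2 * h ^ 2 / (2 * (σ + h)) ≤ a ^ 2 * h ^ 2 / σ := by gcongr; linarith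
    _ = _ := by ring

theorem exists_abs_cramCW_sub_le {ρ : Measure ℝ} [IsProbabilityMeasure ρ] {σ μ K s₁ : ℝ}
    (hσ : 0 < σ) (hμ : σ ^ 2 < μ) (hK : 0 < K) (hs₁ : 0 < s₁)
    (hexp : HasQuarticExpansion ρ σ μ K s₁) {ε : ℝ} (hε : 0 < ε) :
    ∃ δ > 0, ∀ a h : ℝ, |a| ≤ δ → |h| ≤ δ →
      |(cramCW ρ (σ * a) (σ + h)).toReal - (σ * a) ^ 2 / (2 * (σ + h))
        - (h ^ 2 / (2 * (μ - σ ^ 2)) + μ / 12 * a ^ 4)| ≤ ε * (h ^ 2 + a ^ 4) := by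
  obtain ⟨δ₁, hδ₁, hup⟩ := exists_cramCW_le hσ hμ hK hs₁ hexp (half_pos hε)
  obtain ⟨δ₂, hδ₂, hlo⟩ := exists_le_cramCW hμ hK hs₁ hexp (half_pos hε)
  refine ⟨min (min δ₁ δ₂) (min 1 (min (σ / 2) (ε / 2 * σ))), by positivity, fun a h ha hh => ?_⟩
  simp only [le_min_iff] at ha hh
  obtain ⟨⟨ha1, ha2⟩, ha3, -, ha4⟩ := ha
  obtain ⟨⟨hh1, hh2⟩, -, hh3, -⟩ := hh
  have hup := hup a h ha1 hh1
  have hlo := hlo a h ha2 hh2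
  lift cramCW ρ (σ * a) (σ + h) to ℝ using
    ⟨(hup.trans_lt (EReal.coe_lt_top _)).ne, ((EReal.bot_lt_coe _).trans_le hlo).ne'⟩ with I
  rw [EReal.coe_le_coe_iff] at hup hlo
  rw [EReal.toReal_coe]
  have hsq := abs_sq_div_sub_le (a := a) hσ hh3
  have ha2 : a ^ 2 / σ ≤ ε / 2 := by
    rw [div_le_iff₀ hσ, ← sq_abs]
    nlinarith only [abs_nonneg a, ha3, ha4]
  have hsq' := hsq.trans (mul_le_mul_of_nonneg_right ha2 (sq_nonneg h))
  have ha4 : 0 ≤ ε * a ^ 4 := by positivity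
  unfold dualQuarticPart at hup hlo
  rw [abs_le] at hsq' ⊢
  constructor <;> linarith

end CramCW

open Filter Topology in
theorem cramCW_expansion_at_min (ρ : Measure ℝ) [IsProbabilityMeasure ρ]
    (hsym : ρ.map (fun z => -z) = ρ)
    (hsupp : ∃ a b c : ℝ, a ∈ msupport ρ ∧ b ∈ msupport ρ ∧ c ∈ msupport ρ ∧
      a ≠ b ∧ b ≠ c ∧ a ≠ c)
    (hdom : ∃ ε > 0, ∀ u v : ℝ, |u| < ε → |v| < ε → lapCW ρ u v < ⊤)
    (σ2 μ4 : ℝ) (hσ2 : ∫ z, z ^ 2 ∂ρ = σ2) (hμ4 : ∫ z, z ^ 4 ∂ρ = μ4) :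
    Tendsto
      (fun p : ℝ × ℝ =>
        ((cramCW ρ p.1 p.2).toReal - p.1 ^ 2 / (2 * p.2)) /
          ((p.2 - σ2) ^ 2 / (2 * (μ4 - σ2 ^ 2)) + μ4 * p.1 ^ 4 / (12 * σ2 ^ 4)))
      (𝓝[{((0 : ℝ), σ2)}ᶜ] (0, σ2)) (𝓝 1) := by
  obtain ⟨ε₀, hε₀, hdom⟩ := hdom
  have hint : Integrable (fun z => Real.exp (ε₀ / 2 * z ^ 2)) ρ := by
    have h := CramCW.integrable_of_lapCW_lt_top
      (hdom 0 (ε₀ / 2) (by simpa using hε₀) (by rw [abs_of_pos (by positivity)]; linarith))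
    simpa using h
  obtain ⟨hσ, hμ⟩ := CramCW.moments_of_three_support_points hsupp
    (CramCW.integrable_sq_of_exp (half_pos hε₀) hint)
    (CramCW.integrable_pow_four_of_exp (half_pos hε₀) hint) hσ2 hμ4
  obtain ⟨K, hK, s₁, hs₁, hexp⟩ :=
    CramCW.exists_log_lapCW_expansion hsym (half_pos hε₀) hint hσ2 hμ4
  have hexp : CramCW.HasQuarticExpansion ρ σ2 μ4 K s₁ := fun u v huv => by
    refine ⟨(hexp u v huv).1, ?_⟩
    rw [CramCW.quarticPart, ← add_assoc, ← add_assoc]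
    exact (hexp u v huv).2
  have hD : 0 < μ4 - σ2 ^ 2 := sub_pos.2 hμ
  have hμ0 : 0 < μ4 := (sq_nonneg σ2).trans_lt hμ
  obtain ⟨c, hc, hcD, hcμ⟩ : ∃ c > 0, c ≤ 1 / (2 * (μ4 - σ2 ^ 2)) ∧ c ≤ μ4 / 12 :=
    ⟨min (1 / (2 * (μ4 - σ2 ^ 2))) (μ4 / 12), by positivity, min_le_left _ _, min_le_right _ _⟩
  rw [Metric.tendsto_nhds]
  intro ε hε
  obtain ⟨δ, hδ, hbound⟩ :=
    CramCW.exists_abs_cramCW_sub_le hσ hμ hK hs₁ hexp (by positivity : 0 < ε / 2 * c)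
  have hx : ∀ᶠ p : ℝ × ℝ in 𝓝[{((0 : ℝ), σ2)}ᶜ] (0, σ2), |p.1 / σ2| < δ := by
    refine (ContinuousAt.eventually_lt (g := fun _ => δ) ?_ continuousAt_const
      (by simpa using hδ)).filter_mono nhdsWithin_le_nhds
    fun_prop
  have hy : ∀ᶠ p : ℝ × ℝ in 𝓝[{((0 : ℝ), σ2)}ᶜ] (0, σ2), |p.2 - σ2| < δ := by
    refine (ContinuousAt.eventually_lt (g := fun _ => δ) ?_ continuousAt_const
      (by simpa using hδ)).filter_mono nhdsWithin_le_nhds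
    fun_prop
  filter_upwards [hx, hy, self_mem_nhdsWithin] with ⟨x, y⟩ hx hy hne
  obtain ⟨a, rfl⟩ : ∃ a, x = σ2 * a := ⟨x / σ2, by field_simp⟩
  obtain ⟨h, rfl⟩ : ∃ h, y = σ2 + h := ⟨y - σ2, by ring⟩
  dsimp only at hx hy ⊢
  rw [mul_div_cancel_left₀ a hσ.ne'] at hx
  rw [add_sub_cancel_left] at hy ⊢
  have hN : 0 < h ^ 2 + a ^ 4 := by
    by_contra! hcon
    have h1 : h ^ 2 = 0 := by nlinarith [sq_nonneg h, sq_nonneg (a ^ 2)]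
    have h2 : a ^ 4 = 0 := by nlinarith [sq_nonneg h, sq_nonneg (a ^ 2)]
    rw [pow_eq_zero_iff (by norm_num)] at h1 h2
    simp [h1, h2] at hne
  have hT : h ^ 2 / (2 * (μ4 - σ2 ^ 2)) + μ4 * (σ2 * a) ^ 4 / (12 * σ2 ^ 4)
      = h ^ 2 / (2 * (μ4 - σ2 ^ 2)) + μ4 / 12 * a ^ 4 := by
    field_simp
  have hTN : c * (h ^ 2 + a ^ 4) ≤ h ^ 2 / (2 * (μ4 - σ2 ^ 2)) + μ4 / 12 * a ^ 4 := by
    have h1 := mul_le_mul_of_nonneg_right hcD (sq_nonneg h)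
    have h2 := mul_le_mul_of_nonneg_right hcμ (by positivity : 0 ≤ a ^ 4)
    rw [one_div_mul_eq_div] at h1
    linarith
  have hb := hbound a h hx.le hy.le
  rw [hT, Real.dist_eq]
  generalize h ^ 2 / (2 * (μ4 - σ2 ^ 2)) + μ4 / 12 * a ^ 4 = T at hTN hb ⊢
  have hT0 : 0 < T := (by positivity : 0 < c * (h ^ 2 + a ^ 4)).trans_le hTN
  rw [div_sub_one hT0.ne', abs_div, abs_of_pos hT0, div_lt_iff₀ hT0]
  refine hb.trans_lt ?_
  have := mul_le_mul_of_nonneg_left hTN hε.le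
  nlinarith [mul_pos hε hT0]
end

section
/- Let ρ be a symmetric probability measure on ℝ whose support contains at least three points, with (0,0) in the interior of the domain of Λ. Let I be the Cramér transform of the law of (Z, Z²), Z ~ ρ, with variance σ² and fourth moment μ₄. Then ∂³I/∂x²∂y (0, σ²) = −1/σ⁴ and ∂⁴I/∂x⁴ (0, σ²) = 2μ₄/σ⁸. -/
open MeasureTheory ENNReal

open Filter Topology in
/-- Leibniz rule for the second derivative of a product. -/
theorem deriv_deriv_mul {f g : ℝ → ℝ} {x : ℝ} (hf : ContDiffAt ℝ 2 f x) (hg : ContDiffAt ℝ 2 g x) :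
    deriv (deriv (fun t => f t * g t)) x =
      deriv (deriv f) x * g x + 2 * (deriv f x * deriv g x) + f x * deriv (deriv g) x := by
  have h : deriv (fun t => f t * g t) =ᶠ[𝓝 x] fun t => deriv f t * g t + f t * deriv g t := by
    filter_upwards [hf.eventually (by simp), hg.eventually (by simp)] with t hft hgt
    exact deriv_fun_mul (hft.differentiableAt (by simp)) (hgt.differentiableAt (by simp))
  have hf' : DifferentiableAt ℝ (deriv f) x :=
    (hf.derivWithin (m := 1) (by norm_num)).differentiableAt (by simp)
  have hg' : DifferentiableAt ℝ (deriv g) x :=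
    (hg.derivWithin (m := 1) (by norm_num)).differentiableAt (by simp)
  have hf0 := hf.differentiableAt (by simp)
  have hg0 := hg.differentiableAt (by simp)
  rw [h.deriv_eq, deriv_fun_add (hf'.fun_mul hg0) (hf0.fun_mul hg'), deriv_fun_mul hf' hg0,
    deriv_fun_mul hf0 hg']
  ring

open Filter Topology in
/-- The higher derivatives at `0` of a curve `(a, b)` whose velocity solves the linear system
satisfied by the inverse of the gradient map along the line `y = s`. -/
theorem iterate_deriv_of_linear_system {a b m₃ m₄ : ℝ → ℝ} {s μ m₅ : ℝ} (hs : 0 < s)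
    (hv : 0 < μ - s ^ 2) (ha : ContDiffAt ℝ 3 a 0) (hb : ContDiffAt ℝ 3 b 0)
    (h₃ : ContDiffAt ℝ 2 m₃ 0) (h₄ : ContDiffAt ℝ 2 m₄ 0) (h₃0 : m₃ 0 = 0) (h₄0 : m₄ 0 = μ)
    (hd : deriv m₃ 0 = deriv a 0 * μ + deriv b 0 * m₅)
    (eq₁ : ∀ᶠ x in 𝓝 0, deriv a x * (s - x ^ 2) + deriv b x * (m₃ x - s * x) = 1)
    (eq₂ : ∀ᶠ x in 𝓝 0, deriv a x * (m₃ x - s * x) + deriv b x * (m₄ x - s ^ 2) = 0) :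
    deriv^[2] b 0 = -(1 / s ^ 2) ∧ deriv^[3] a 0 = 2 * μ / s ^ 4 := by
  have hA : ContDiffAt ℝ 2 (deriv a) 0 := ha.derivWithin (by norm_num)
  have hB : ContDiffAt ℝ 2 (deriv b) 0 := hb.derivWithin (by norm_num)
  have hP : ContDiffAt ℝ 2 (fun x : ℝ => s - x ^ 2) 0 := by fun_prop
  have hw : ContDiffAt ℝ 2 (fun x : ℝ => m₃ x - s * x) 0 := by fun_prop
  have hz : ContDiffAt ℝ 2 (fun x : ℝ => m₄ x - s ^ 2) 0 := by fun_prop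
  have hA0 : deriv a 0 = 1 / s := by
    have := eq₁.self_of_nhds
    simp only [h₃0] at this
    field_simp
    linarith
  have hB0 : deriv b 0 = 0 := by
    have := eq₂.self_of_nhds
    simp only [h₃0, h₄0] at this
    have h : deriv b 0 * (μ - s ^ 2) = 0 := by linarith
    exact (mul_eq_zero.1 h).resolve_right hv.ne'
  have hw1 : deriv (fun x : ℝ => m₃ x - s * x) 0 = μ / s - s := by
    rw [deriv_fun_sub (h₃.differentiableAt (by simp)) (by fun_prop), hd, hA0, hB0]
    simp
    ring
  have hP1 : deriv (fun x : ℝ => s - x ^ 2) = fun x => -2 * x := by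
    funext x
    simp
  have hP2 : deriv (deriv (fun x : ℝ => s - x ^ 2)) 0 = -2 := by
    rw [hP1, deriv_const_mul_field]
    simp
  have hb2 : deriv (deriv b) 0 = -(1 / s ^ 2) := by
    have e : (fun x => deriv a x * (m₃ x - s * x) + deriv b x * (m₄ x - s ^ 2)) =ᶠ[𝓝 0]
        fun _ => 0 := eq₂
    have e' := e.deriv_eq
    have dA := hA.differentiableAt (by simp)
    have dB := hB.differentiableAt (by simp)
    have dw := hw.differentiableAt (by simp)
    have dz := hz.differentiableAt (by simp)
    rw [deriv_fun_add (dA.fun_mul dw) (dB.fun_mul dz), deriv_fun_mul dA dw, deriv_fun_mul dB dz,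
      hw1] at e'
    simp only [h₃0, h₄0, hA0, hB0, deriv_const] at e'
    have h : deriv (deriv b) 0 * (μ - s ^ 2) = -(1 / s ^ 2) * (μ - s ^ 2) := by
      rw [show -(1 / s ^ 2) * (μ - s ^ 2) = -(1 / s * (μ / s - s)) by field_simp]
      linarith
    exact mul_right_cancel₀ hv.ne' h
  refine ⟨hb2, ?_⟩
  have e : (fun x => deriv a x * (s - x ^ 2) + deriv b x * (m₃ x - s * x)) =ᶠ[𝓝 0]
      fun _ => 1 := eq₁
  have e' := e.deriv.deriv_eq
  have hsum : deriv (fun x => deriv a x * (s - x ^ 2) + deriv b x * (m₃ x - s * x)) =ᶠ[𝓝 0]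
      fun x => deriv (fun x => deriv a x * (s - x ^ 2)) x +
        deriv (fun x => deriv b x * (m₃ x - s * x)) x := by
    filter_upwards [(hA.mul hP).eventually (by simp), (hB.mul hw).eventually (by simp)] with x h h'
    exact deriv_fun_add (h.differentiableAt (by simp)) (h'.differentiableAt (by simp))
  rw [hsum.deriv_eq, deriv_fun_add
    (((hA.mul hP).derivWithin (m := 1) (by norm_num)).differentiableAt (by simp))
    (((hB.mul hw).derivWithin (m := 1) (by norm_num)).differentiableAt (by simp)),
    deriv_deriv_mul hA hP, deriv_deriv_mul hB hw, hw1, hP2, hP1, hb2] at e'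
  simp only [h₃0, hA0, hB0, deriv_const', deriv_const] at e'
  change deriv (deriv (deriv a)) 0 = _
  field_simp at e' ⊢
  linarith

/-- The moments of `ρ` with exponential weight `exp (u z + v z ^ 2)`. -/
noncomputable def expMoment (ρ : Measure ℝ) (k : ℕ) (p : ℝ × ℝ) : ℝ :=
  ∫ z, z ^ k * Real.exp (p.1 * z + p.2 * z ^ 2) ∂ρ

/-- The moments of the exponentially tilted probability measure. -/
noncomputable def tiltMoment (ρ : Measure ℝ) (k : ℕ) (p : ℝ × ℝ) : ℝ :=
  expMoment ρ k p / expMoment ρ 0 p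

theorem mem_ball_zero_prod {c : ℝ} {p : ℝ × ℝ} (hp : p ∈ Metric.ball (0 : ℝ × ℝ) c) :
    |p.1| < c ∧ |p.2| < c := by
  simpa [Prod.norm_def] using hp

theorem abs_pow_mul_exp_le {c : ℝ} (hc : 0 < c) (hc1 : c ≤ 1) (k : ℕ) {p : ℝ × ℝ}
    (hp : p ∈ Metric.ball (0 : ℝ × ℝ) c) (z : ℝ) :
    |z| ^ k * Real.exp (p.1 * z + p.2 * z ^ 2) ≤
      k.factorial * Real.exp (1 / c) * Real.exp (2 * c * z ^ 2) := by
  obtain ⟨h1, h2⟩ := mem_ball_zero_prod hp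
  have h3 : |z| ^ k ≤ k.factorial * Real.exp |z| := by
    have := Real.pow_div_factorial_le_exp |z| (abs_nonneg z) k
    rwa [div_le_iff₀' (by positivity)] at this
  have h4 : p.1 * z ≤ |z| := by
    refine (le_abs_self _).trans ?_
    rw [abs_mul]
    exact mul_le_of_le_one_left (abs_nonneg _) (h1.le.trans hc1)
  have h5 : p.2 * z ^ 2 ≤ c * z ^ 2 :=
    mul_le_mul_of_nonneg_right ((le_abs_self _).trans h2.le) (sq_nonneg z)
  have h6 : 2 * |z| ≤ 1 / c + c * z ^ 2 := by
    have : 1 / c + c * z ^ 2 - 2 * |z| = (1 - c * |z|) ^ 2 / c := by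
      rw [← sq_abs z]
      field_simp
      ring
    have h : 0 ≤ (1 - c * |z|) ^ 2 / c := by positivity
    linarith
  calc |z| ^ k * Real.exp (p.1 * z + p.2 * z ^ 2)
      ≤ k.factorial * Real.exp |z| * Real.exp (p.1 * z + p.2 * z ^ 2) := by gcongr
    _ = k.factorial * Real.exp (|z| + (p.1 * z + p.2 * z ^ 2)) := by
        rw [Real.exp_add |z|]; ring
    _ ≤ k.factorial * Real.exp (1 / c + 2 * c * z ^ 2) :=
        mul_le_mul_of_nonneg_left (Real.exp_le_exp.2 (by linarith)) (by positivity)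
    _ = _ := by rw [Real.exp_add]; ring

theorem integrable_pow_mul_exp {ρ : Measure ℝ} {c : ℝ} (hc : 0 < c) (hc1 : c ≤ 1)
    (hint : Integrable (fun z => Real.exp (2 * c * z ^ 2)) ρ) (k : ℕ) {p : ℝ × ℝ}
    (hp : p ∈ Metric.ball (0 : ℝ × ℝ) c) :
    Integrable (fun z => z ^ k * Real.exp (p.1 * z + p.2 * z ^ 2)) ρ := by
  refine (hint.const_mul (k.factorial * Real.exp (1 / c))).mono'
    (Continuous.aestronglyMeasurable (by fun_prop)) (ae_of_all _ fun z => ?_)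
  rw [norm_mul, norm_pow, Real.norm_eq_abs, Real.norm_eq_abs, Real.abs_exp]
  exact abs_pow_mul_exp_le hc hc1 k hp z

theorem expMoment_zero_pos {ρ : Measure ℝ} [NeZero ρ] {c : ℝ} (hc : 0 < c) (hc1 : c ≤ 1)
    (hint : Integrable (fun z => Real.exp (2 * c * z ^ 2)) ρ) {p : ℝ × ℝ}
    (hp : p ∈ Metric.ball (0 : ℝ × ℝ) c) : 0 < expMoment ρ 0 p := by
  have := integrable_pow_mul_exp hc hc1 hint 0 hp
  simp only [pow_zero, one_mul] at this
  simpa [expMoment] using integral_exp_pos this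

theorem hasFDerivAt_expMoment {ρ : Measure ℝ} {c : ℝ} (hc : 0 < c) (hc1 : c ≤ 1)
    (hint : Integrable (fun z => Real.exp (2 * c * z ^ 2)) ρ) (k : ℕ) {p : ℝ × ℝ}
    (hp : p ∈ Metric.ball (0 : ℝ × ℝ) c) :
    HasFDerivAt (expMoment ρ k)
      (expMoment ρ (k + 1) p • ContinuousLinearMap.fst ℝ ℝ ℝ +
        expMoment ρ (k + 2) p • ContinuousLinearMap.snd ℝ ℝ ℝ) p := by
  let e : ℝ × ℝ → ℝ → ℝ := fun q z => Real.exp (q.1 * z + q.2 * z ^ 2)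
  let F' : ℝ × ℝ → ℝ → (ℝ × ℝ →L[ℝ] ℝ) := fun q z =>
    (z ^ (k + 1) * e q z) • ContinuousLinearMap.fst ℝ ℝ ℝ +
      (z ^ (k + 2) * e q z) • ContinuousLinearMap.snd ℝ ℝ ℝ
  have i1 := integrable_pow_mul_exp hc hc1 hint (k + 1) hp
  have i2 := integrable_pow_mul_exp hc hc1 hint (k + 2) hp
  have key : HasFDerivAt (fun q => ∫ z, z ^ k * e q z ∂ρ) (∫ z, F' p z ∂ρ) p := by
    refine hasFDerivAt_integral_of_dominated_of_fderiv_le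
      (s := Metric.ball 0 c)
      (bound := fun z => (k + 1).factorial * Real.exp (1 / c) * Real.exp (2 * c * z ^ 2) +
        (k + 2).factorial * Real.exp (1 / c) * Real.exp (2 * c * z ^ 2))
      (Metric.isOpen_ball.mem_nhds hp)
      (Filter.Eventually.of_forall fun q => Continuous.aestronglyMeasurable (by fun_prop))
      (integrable_pow_mul_exp hc hc1 hint k hp)
      (Continuous.aestronglyMeasurable (by fun_prop))
      (ae_of_all _ fun z q hq => ?_)
      ((hint.const_mul _).add (hint.const_mul _))
      (ae_of_all _ fun z q hq => ?_)
    · refine (norm_add_le _ _).trans (add_le_add ?_ ?_)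
      · rw [norm_smul, norm_mul, norm_pow, Real.norm_eq_abs, Real.norm_eq_abs, Real.abs_exp]
        exact (mul_le_of_le_one_right (by positivity) (ContinuousLinearMap.norm_fst_le ℝ ℝ ℝ)).trans
          (abs_pow_mul_exp_le hc hc1 (k + 1) hq z)
      · rw [norm_smul, norm_mul, norm_pow, Real.norm_eq_abs, Real.norm_eq_abs, Real.abs_exp]
        exact (mul_le_of_le_one_right (by positivity) (ContinuousLinearMap.norm_snd_le ℝ ℝ ℝ)).trans
          (abs_pow_mul_exp_le hc hc1 (k + 2) hq z)
    · have h : HasFDerivAt (fun q : ℝ × ℝ => q.1 * z + q.2 * z ^ 2)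
          (z • ContinuousLinearMap.fst ℝ ℝ ℝ + z ^ 2 • ContinuousLinearMap.snd ℝ ℝ ℝ) q :=
        (hasFDerivAt_fst.mul_const z).add (hasFDerivAt_snd.mul_const (z ^ 2))
      refine (h.exp.const_mul (z ^ k)).congr_fderiv ?_
      ext <;> simp [F', e] <;> ring
  refine key.congr_fderiv ?_
  rw [integral_add (i1.smul_const _) (i2.smul_const _), integral_smul_const, integral_smul_const]
  rfl

theorem hasFDerivAt_tiltMoment {ρ : Measure ℝ} [NeZero ρ] {c : ℝ} (hc : 0 < c) (hc1 : c ≤ 1)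
    (hint : Integrable (fun z => Real.exp (2 * c * z ^ 2)) ρ) (k : ℕ) {p : ℝ × ℝ}
    (hp : p ∈ Metric.ball (0 : ℝ × ℝ) c) :
    HasFDerivAt (tiltMoment ρ k)
      ((tiltMoment ρ (k + 1) p - tiltMoment ρ k p * tiltMoment ρ 1 p) •
          ContinuousLinearMap.fst ℝ ℝ ℝ +
        (tiltMoment ρ (k + 2) p - tiltMoment ρ k p * tiltMoment ρ 2 p) •
          ContinuousLinearMap.snd ℝ ℝ ℝ) p := by
  have h0 := (expMoment_zero_pos hc hc1 hint hp).ne'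
  have h := (hasFDerivAt_expMoment hc hc1 hint k hp).mul
    ((hasDerivAt_inv h0).comp_hasFDerivAt p (hasFDerivAt_expMoment hc hc1 hint 0 hp))
  have e : tiltMoment ρ k = expMoment ρ k * (Inv.inv ∘ expMoment ρ 0) := by
    funext q
    simp [tiltMoment, div_eq_mul_inv]
  rw [e]
  refine h.congr_fderiv ?_
  ext <;> simp [tiltMoment] <;> field_simp <;> ring

theorem contDiffOn_tiltMoment {ρ : Measure ℝ} [NeZero ρ] {c : ℝ} (hc : 0 < c) (hc1 : c ≤ 1)
    (hint : Integrable (fun z => Real.exp (2 * c * z ^ 2)) ρ) (n : ℕ) (k : ℕ) :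
    ContDiffOn ℝ n (tiltMoment ρ k) (Metric.ball 0 c) := by
  induction n generalizing k with
  | zero =>
    exact contDiffOn_zero.2 fun p hp =>
      (hasFDerivAt_tiltMoment hc hc1 hint k hp).continuousAt.continuousWithinAt
  | succ n ih =>
    push_cast
    refine (contDiffOn_succ_iff_fderiv_of_isOpen Metric.isOpen_ball).2
      ⟨fun p hp => (hasFDerivAt_tiltMoment hc hc1 hint k hp).differentiableAt.differentiableWithinAt,
        by simp, ?_⟩
    have h : ContDiffOn ℝ n (fun p =>
        (tiltMoment ρ (k + 1) p - tiltMoment ρ k p * tiltMoment ρ 1 p) •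
          ContinuousLinearMap.fst ℝ ℝ ℝ +
        (tiltMoment ρ (k + 2) p - tiltMoment ρ k p * tiltMoment ρ 2 p) •
          ContinuousLinearMap.snd ℝ ℝ ℝ) (Metric.ball 0 c) :=
      (((ih (k + 1)).sub ((ih k).mul (ih 1))).smul contDiffOn_const).add
        (((ih (k + 2)).sub ((ih k).mul (ih 2))).smul contDiffOn_const)
    exact h.congr fun p hp => (hasFDerivAt_tiltMoment hc hc1 hint k hp).fderiv

theorem hasFDerivAt_log_expMoment {ρ : Measure ℝ} [NeZero ρ] {c : ℝ} (hc : 0 < c) (hc1 : c ≤ 1)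
    (hint : Integrable (fun z => Real.exp (2 * c * z ^ 2)) ρ) {p : ℝ × ℝ}
    (hp : p ∈ Metric.ball (0 : ℝ × ℝ) c) :
    HasFDerivAt (fun q => Real.log (expMoment ρ 0 q))
      (tiltMoment ρ 1 p • ContinuousLinearMap.fst ℝ ℝ ℝ +
        tiltMoment ρ 2 p • ContinuousLinearMap.snd ℝ ℝ ℝ) p := by
  refine ((hasFDerivAt_expMoment hc hc1 hint 0 hp).log
    (expMoment_zero_pos hc hc1 hint hp).ne').congr_fderiv ?_
  ext <;> simp [tiltMoment] <;> ring

theorem lapCW_eq_ofReal_expMoment {ρ : Measure ℝ} {u v : ℝ}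
    (h : Integrable (fun z => Real.exp (u * z + v * z ^ 2)) ρ) :
    lapCW ρ u v = ENNReal.ofReal (expMoment ρ 0 (u, v)) := by
  simp only [lapCW, expMoment, pow_zero, one_mul]
  exact (ofReal_integral_eq_lintegral_ofReal h (ae_of_all _ fun z => (Real.exp_pos _).le)).symm

theorem integrable_of_lapCW_lt_top {ρ : Measure ℝ} {u v : ℝ} (h : lapCW ρ u v < ⊤) :
    Integrable (fun z => Real.exp (u * z + v * z ^ 2)) ρ :=
  (lintegral_ofReal_ne_top_iff_integrable (Continuous.aestronglyMeasurable (by fun_prop))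
    (ae_of_all _ fun z => (Real.exp_pos _).le)).1 h.ne

/-- The supporting hyperplane inequality for the log-Laplace transform. -/
theorem log_expMoment_add_le {ρ : Measure ℝ} [NeZero ρ] {c : ℝ} (hc : 0 < c) (hc1 : c ≤ 1)
    (hint : Integrable (fun z => Real.exp (2 * c * z ^ 2)) ρ) {p : ℝ × ℝ}
    (hp : p ∈ Metric.ball (0 : ℝ × ℝ) c) {q : ℝ × ℝ}
    (hq : Integrable (fun z => Real.exp (q.1 * z + q.2 * z ^ 2)) ρ) :
    Real.log (expMoment ρ 0 p) + (tiltMoment ρ 1 p * (q.1 - p.1) + tiltMoment ρ 2 p * (q.2 - p.2)) ≤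
      Real.log (expMoment ρ 0 q) := by
  have h0 := expMoment_zero_pos hc hc1 hint hp
  set t := tiltMoment ρ 1 p * (q.1 - p.1) + tiltMoment ρ 2 p * (q.2 - p.2) with ht
  have i0 := integrable_pow_mul_exp hc hc1 hint 0 hp
  have i1 := integrable_pow_mul_exp hc hc1 hint 1 hp
  have i2 := integrable_pow_mul_exp hc hc1 hint 2 hp
  have hlow : Real.exp t * expMoment ρ 0 p ≤ expMoment ρ 0 q := by
    have e : Real.exp t * expMoment ρ 0 p =
        ∫ z, Real.exp t * ((1 - t) * (z ^ 0 * Real.exp (p.1 * z + p.2 * z ^ 2)) +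
          (q.1 - p.1) * (z ^ 1 * Real.exp (p.1 * z + p.2 * z ^ 2)) +
          (q.2 - p.2) * (z ^ 2 * Real.exp (p.1 * z + p.2 * z ^ 2))) ∂ρ := by
      rw [integral_const_mul, integral_add ((i0.const_mul _).fun_add (i1.const_mul _))
        (i2.const_mul _), integral_add (i0.const_mul _) (i1.const_mul _), integral_const_mul,
        integral_const_mul, integral_const_mul]
      change _ = Real.exp t * ((1 - t) * expMoment ρ 0 p + (q.1 - p.1) * expMoment ρ 1 p +
        (q.2 - p.2) * expMoment ρ 2 p)
      have ht' : t * expMoment ρ 0 p =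
          (q.1 - p.1) * expMoment ρ 1 p + (q.2 - p.2) * expMoment ρ 2 p := by
        rw [ht, tiltMoment, tiltMoment]
        field_simp
      linear_combination Real.exp t * ht'
    rw [e]
    refine integral_mono ((((i0.const_mul _).add (i1.const_mul _)).add
      (i2.const_mul _)).const_mul _) (by simpa using hq) fun z => ?_
    have hz : q.1 * z + q.2 * z ^ 2 = t + (p.1 * z + p.2 * z ^ 2) +
        ((q.1 - p.1) * z + (q.2 - p.2) * z ^ 2 - t) := by ring
    simp only [pow_zero, one_mul, pow_one]
    rw [hz, Real.exp_add (t + _), Real.exp_add t]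
    have := mul_le_mul_of_nonneg_left
      (Real.add_one_le_exp ((q.1 - p.1) * z + (q.2 - p.2) * z ^ 2 - t))
      (mul_pos (Real.exp_pos t) (Real.exp_pos (p.1 * z + p.2 * z ^ 2))).le
    linarith
  have := Real.log_le_log (by positivity) hlow
  rw [Real.log_mul (Real.exp_pos t).ne' h0.ne', Real.log_exp] at this
  linarith

/-- The Legendre duality formula at a point in the image of the gradient map. -/
theorem cramCW_tiltMoment {ρ : Measure ℝ} [NeZero ρ] {c : ℝ} (hc : 0 < c) (hc1 : c ≤ 1)
    (hint : Integrable (fun z => Real.exp (2 * c * z ^ 2)) ρ) {p : ℝ × ℝ}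
    (hp : p ∈ Metric.ball (0 : ℝ × ℝ) c) :
    cramCW ρ (tiltMoment ρ 1 p) (tiltMoment ρ 2 p) =
      ((tiltMoment ρ 1 p * p.1 + tiltMoment ρ 2 p * p.2 - Real.log (expMoment ρ 0 p) : ℝ) :
        EReal) := by
  have hlog : ∀ q : ℝ × ℝ, Integrable (fun z => Real.exp (q.1 * z + q.2 * z ^ 2)) ρ →
      ENNReal.log (lapCW ρ q.1 q.2) = (Real.log (expMoment ρ 0 q) : EReal) := fun q hq => by
    rw [lapCW_eq_ofReal_expMoment hq]
    refine ENNReal.log_ofReal_of_pos ?_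
    simpa [expMoment] using integral_exp_pos hq
  have hpi : Integrable (fun z => Real.exp (p.1 * z + p.2 * z ^ 2)) ρ := by
    simpa using integrable_pow_mul_exp hc hc1 hint 0 hp
  refine le_antisymm (iSup_le fun q => ?_) (le_iSup_of_le p ?_)
  · by_cases h : lapCW ρ q.1 q.2 < ⊤
    · have hq := integrable_of_lapCW_lt_top h
      rw [hlog q hq, ← EReal.coe_sub, EReal.coe_le_coe_iff]
      linarith [log_expMoment_add_le hc hc1 hint hp hq]
    · rw [not_lt_top_iff.1 h, ENNReal.log_top, EReal.sub_top]
      exact bot_le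
  · rw [hlog p hpi, EReal.coe_sub]

open Filter Topology in
theorem eventually_hasFDerivAt_cramCW {ρ : Measure ℝ} [NeZero ρ] {c : ℝ} (hc : 0 < c)
    (hc1 : c ≤ 1) (hint : Integrable (fun z => Real.exp (2 * c * z ^ 2)) ρ)
    {h : ℝ × ℝ → ℝ × ℝ} {w₀ : ℝ × ℝ} (hh : ∀ᶠ w in 𝓝 w₀, DifferentiableAt ℝ h w)
    (hball : ∀ᶠ w in 𝓝 w₀, h w ∈ Metric.ball (0 : ℝ × ℝ) c)
    (hinv : ∀ᶠ w in 𝓝 w₀, (tiltMoment ρ 1 (h w), tiltMoment ρ 2 (h w)) = w) :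
    ∀ᶠ w in 𝓝 w₀, HasFDerivAt (fun w : ℝ × ℝ => (cramCW ρ w.1 w.2).toReal)
      ((h w).1 • ContinuousLinearMap.fst ℝ ℝ ℝ + (h w).2 • ContinuousLinearMap.snd ℝ ℝ ℝ) w := by
  filter_upwards [hh, hball.eventually_nhds, hinv.eventually_nhds] with w hd hb hi
  have e : (fun w : ℝ × ℝ => (cramCW ρ w.1 w.2).toReal) =ᶠ[𝓝 w]
      fun w => w.1 * (h w).1 + w.2 * (h w).2 - Real.log (expMoment ρ 0 (h w)) := by
    filter_upwards [hb, hi] with w hb hi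
    obtain ⟨h1, h2⟩ := Prod.ext_iff.1 hi
    have := cramCW_tiltMoment hc hc1 hint hb
    simp only at h1 h2
    rw [h1, h2] at this
    rw [this, EReal.toReal_coe]
  obtain ⟨h1, h2⟩ := Prod.ext_iff.1 hi.self_of_nhds
  simp only at h1 h2
  have hd' := hd.hasFDerivAt
  have hl := (hasFDerivAt_log_expMoment hc hc1 hint hb.self_of_nhds).comp w hd'
  rw [h1, h2] at hl
  refine HasFDerivAt.congr_of_eventuallyEq ?_ e
  refine (((hasFDerivAt_fst.mul hd'.fst).add (hasFDerivAt_snd.mul hd'.snd)).sub hl).congr_fderiv ?_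
  ext <;> simp

open Filter Topology in
theorem exists_inverse_tiltMoment {ρ : Measure ℝ} [NeZero ρ] {c : ℝ} (hc : 0 < c)
    (hc1 : c ≤ 1) (hint : Integrable (fun z => Real.exp (2 * c * z ^ 2)) ρ) {s μ : ℝ}
    (hs : 0 < s) (hv : 0 < μ - s ^ 2) (h₁ : tiltMoment ρ 1 0 = 0) (h₂ : tiltMoment ρ 2 0 = s)
    (h₃ : tiltMoment ρ 3 0 = 0) (h₄ : tiltMoment ρ 4 0 = μ) :
    ∃ h : ℝ × ℝ → ℝ × ℝ, ContDiffAt ℝ 3 h (0, s) ∧ h (0, s) = 0 ∧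
      ∀ᶠ w in 𝓝 (0, s), (tiltMoment ρ 1 (h w), tiltMoment ρ 2 (h w)) = w := by
  have h0 : (0 : ℝ × ℝ) ∈ Metric.ball (0 : ℝ × ℝ) c := Metric.mem_ball_self hc
  have hn : Metric.ball (0 : ℝ × ℝ) c ∈ 𝓝 0 := Metric.isOpen_ball.mem_nhds h0
  have hsmooth : ContDiffAt ℝ 3 (fun p => (tiltMoment ρ 1 p, tiltMoment ρ 2 p)) 0 :=
    ((contDiffOn_tiltMoment hc hc1 hint 3 1).contDiffAt hn).prodMk
      ((contDiffOn_tiltMoment hc hc1 hint 3 2).contDiffAt hn)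
  let E : (ℝ × ℝ) ≃L[ℝ] (ℝ × ℝ) :=
    (ContinuousLinearEquiv.unitsEquivAut ℝ (Units.mk0 s hs.ne')).prodCongr
      (ContinuousLinearEquiv.unitsEquivAut ℝ (Units.mk0 (μ - s ^ 2) hv.ne'))
  have hderiv : HasFDerivAt (fun p => (tiltMoment ρ 1 p, tiltMoment ρ 2 p))
      (E : ℝ × ℝ →L[ℝ] ℝ × ℝ) 0 := by
    refine ((hasFDerivAt_tiltMoment hc hc1 hint 1 h0).prodMk
      (hasFDerivAt_tiltMoment hc hc1 hint 2 h0)).congr_fderiv ?_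
    ext <;> simp [E, h₁, h₂, h₃, h₄, sq]
  have e0 : (tiltMoment ρ 1 0, tiltMoment ρ 2 0) = ((0, s) : ℝ × ℝ) := by rw [h₁, h₂]
  refine ⟨hsmooth.localInverse hderiv (by simp), ?_, ?_, ?_⟩
  · have := hsmooth.to_localInverse hderiv (by simp)
    rwa [e0] at this
  · have := hsmooth.localInverse_apply_image hderiv (by simp)
    rwa [e0] at this
  · have := (hsmooth.hasStrictFDerivAt' hderiv (by simp)).eventually_right_inverse
    rwa [e0] at this

theorem sq_eq_of_mem_msupport {ρ : Measure ℝ} {r x : ℝ} (h : ∀ᵐ z ∂ρ, z ^ 2 = r)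
    (hx : x ∈ msupport ρ) : x ^ 2 = r := by
  by_contra hne
  have hopen : IsOpen {z : ℝ | z ^ 2 ≠ r} := isOpen_ne_fun (by fun_prop) (by fun_prop)
  exact hx _ (hopen.mem_nhds hne) h

theorem not_ae_sq_eq {ρ : Measure ℝ}
    (hsupp : ∃ a b c : ℝ, a ∈ msupport ρ ∧ b ∈ msupport ρ ∧ c ∈ msupport ρ ∧
      a ≠ b ∧ b ≠ c ∧ a ≠ c) (r : ℝ) : ¬ ∀ᵐ z ∂ρ, z ^ 2 = r := by
  intro h
  obtain ⟨a, b, c, ha, hb, hc, hab, hbc, hac⟩ := hsupp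
  have ha := sq_eq_of_mem_msupport h ha
  have hb := sq_eq_of_mem_msupport h hb
  have hc := sq_eq_of_mem_msupport h hc
  have h1 := (sq_eq_sq_iff_eq_or_eq_neg.1 (ha.trans hb.symm)).resolve_left hab
  have h2 := (sq_eq_sq_iff_eq_or_eq_neg.1 (hc.trans hb.symm)).resolve_left hbc.symm
  exact hac (h1.trans h2.symm)

theorem integral_odd_pow_eq_zero {ρ : Measure ℝ} (hsym : ρ.map (fun z => -z) = ρ) {k : ℕ}
    (hk : Odd k) : ∫ z, z ^ k ∂ρ = 0 := by
  have h : ∫ z, z ^ k ∂ρ.map (fun z => -z) = ∫ z, (-z) ^ k ∂ρ :=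
    integral_map (by fun_prop) (Continuous.aestronglyMeasurable (by fun_prop))
  rw [hsym] at h
  simp only [hk.neg_pow, integral_neg] at h
  linarith

theorem tiltMoment_at_zero (ρ : Measure ℝ) [IsProbabilityMeasure ρ] (k : ℕ) :
    tiltMoment ρ k 0 = ∫ z, z ^ k ∂ρ := by
  simp [tiltMoment, expMoment]

open Filter Topology in
theorem cramCW_higher_derivatives (ρ : Measure ℝ) [IsProbabilityMeasure ρ]
    (hsym : ρ.map (fun z => -z) = ρ)
    (hsupp : ∃ a b c : ℝ, a ∈ msupport ρ ∧ b ∈ msupport ρ ∧ c ∈ msupport ρ ∧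
      a ≠ b ∧ b ≠ c ∧ a ≠ c)
    (hdom : ∃ ε > 0, ∀ u v : ℝ, |u| < ε → |v| < ε → lapCW ρ u v < ⊤)
    (σ2 μ4 : ℝ) (hσ2 : ∫ z, z ^ 2 ∂ρ = σ2) (hμ4 : ∫ z, z ^ 4 ∂ρ = μ4) :
    deriv^[2] (fun x => deriv (fun y => (cramCW ρ x y).toReal) σ2) 0 = -(1 / σ2 ^ 2) ∧
    deriv^[4] (fun x => (cramCW ρ x σ2).toReal) 0 = 2 * μ4 / σ2 ^ 4 := by

  obtain ⟨ε, hε, hfin⟩ := hdom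
  obtain ⟨c, hc, hc1, hint⟩ : ∃ c : ℝ, 0 < c ∧ c ≤ 1 ∧
      Integrable (fun z => Real.exp (2 * c * z ^ 2)) ρ := by
    have hc : 0 < min 1 (ε / 4) := by positivity
    refine ⟨min 1 (ε / 4), hc, min_le_left _ _, ?_⟩
    have hlt : |2 * min 1 (ε / 4)| < ε := by
      rw [abs_of_pos (by positivity)]
      linarith [min_le_right 1 (ε / 4)]
    simpa using integrable_of_lapCW_lt_top (hfin 0 (2 * min 1 (ε / 4)) (by simpa) hlt)
  have h0 : (0 : ℝ × ℝ) ∈ Metric.ball (0 : ℝ × ℝ) c := Metric.mem_ball_self hc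
  have hpow : ∀ k : ℕ, Integrable (fun z : ℝ => z ^ k) ρ := fun k => by
    simpa using integrable_pow_mul_exp hc hc1 hint k h0
  have hs : 0 < σ2 := by
    refine lt_of_le_of_ne (hσ2 ▸ integral_nonneg fun z => sq_nonneg z) fun h => ?_
    rw [← h, integral_eq_zero_iff_of_nonneg (fun z => sq_nonneg z) (hpow 2)] at hσ2
    exact not_ae_sq_eq hsupp 0 hσ2
  have hv : 0 < μ4 - σ2 ^ 2 := by
    have hi : Integrable (fun z : ℝ => (z ^ 2 - σ2) ^ 2) ρ := by
      refine (((hpow 4).sub ((hpow 2).const_mul (2 * σ2))).add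
        (integrable_const (σ2 ^ 2))).congr (ae_of_all _ fun z => ?_)
      simp only [Pi.add_apply, Pi.sub_apply]
      ring
    have hval : ∫ z, (z ^ 2 - σ2) ^ 2 ∂ρ = μ4 - σ2 ^ 2 := by
      have : ∀ z : ℝ, (z ^ 2 - σ2) ^ 2 = z ^ 4 + -(2 * σ2) * z ^ 2 + σ2 ^ 2 := fun z => by ring
      simp only [this]
      rw [integral_add ((hpow 4).fun_add ((hpow 2).const_mul _)) (integrable_const _),
        integral_add (hpow 4) ((hpow 2).const_mul _), integral_const_mul, hσ2, hμ4]
      simp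
      ring
    rw [← hval]
    refine lt_of_le_of_ne (integral_nonneg fun z => sq_nonneg _) fun h => ?_
    have h' := (integral_eq_zero_iff_of_nonneg (fun z => sq_nonneg _) hi).1 h.symm
    refine not_ae_sq_eq hsupp σ2 (h'.mono fun z hz => ?_)
    exact sub_eq_zero.1 (pow_eq_zero_iff two_ne_zero |>.1 hz)
  have t₁ : tiltMoment ρ 1 0 = 0 := by
    rw [tiltMoment_at_zero, integral_odd_pow_eq_zero hsym (by decide)]
  have t₂ : tiltMoment ρ 2 0 = σ2 := by rw [tiltMoment_at_zero, hσ2]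
  have t₃ : tiltMoment ρ 3 0 = 0 := by
    rw [tiltMoment_at_zero, integral_odd_pow_eq_zero hsym (by decide)]
  have t₄ : tiltMoment ρ 4 0 = μ4 := by rw [tiltMoment_at_zero, hμ4]
  obtain ⟨h, hsmooth, hzero, hinv⟩ :=
    exists_inverse_tiltMoment hc hc1 hint hs hv t₁ t₂ t₃ t₄
  have hball : ∀ᶠ w in 𝓝 (0, σ2), h w ∈ Metric.ball (0 : ℝ × ℝ) c :=
    hsmooth.continuousAt (Metric.isOpen_ball.mem_nhds (hzero ▸ h0))
  have hdiff : ∀ᶠ w in 𝓝 (0, σ2), DifferentiableAt ℝ h w :=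
    (hsmooth.eventually (by simp)).mono fun w hw => hw.differentiableAt (by simp)
  have hF := eventually_hasFDerivAt_cramCW hc hc1 hint hdiff hball hinv
  have hline : Tendsto (fun x : ℝ => (x, σ2)) (𝓝 0) (𝓝 (0, σ2)) :=
    Continuous.tendsto (by fun_prop) 0
  have hγ : ContDiffAt ℝ 3 (fun x : ℝ => h (x, σ2)) 0 :=
    ContDiffAt.comp (0 : ℝ) hsmooth (by fun_prop)
  have ha := hγ.fst
  have hb := hγ.snd
  have hmem : Metric.ball (0 : ℝ × ℝ) c ∈ 𝓝 (h (0, σ2)) :=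
    Metric.isOpen_ball.mem_nhds (hzero ▸ h0)
  have hm : ∀ k, ContDiffAt ℝ 2 (fun x : ℝ => tiltMoment ρ k (h (x, σ2))) 0 := fun k =>
    ContDiffAt.comp (0 : ℝ) ((contDiffOn_tiltMoment hc hc1 hint 2 k).contDiffAt hmem)
      (hγ.of_le (by norm_num))
  have hinvl : ∀ᶠ x in 𝓝 (0 : ℝ), tiltMoment ρ 1 (h (x, σ2)) = x ∧
      tiltMoment ρ 2 (h (x, σ2)) = σ2 :=
    (hline.eventually hinv).mono fun x hx => Prod.ext_iff.1 hx
  have hmd : ∀ᶠ x in 𝓝 (0 : ℝ), ∀ k, HasDerivAt (fun x : ℝ => tiltMoment ρ k (h (x, σ2)))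
      ((tiltMoment ρ (k + 1) (h (x, σ2)) - tiltMoment ρ k (h (x, σ2)) * x) *
          deriv (fun x => (h (x, σ2)).1) x +
        (tiltMoment ρ (k + 2) (h (x, σ2)) - tiltMoment ρ k (h (x, σ2)) * σ2) *
          deriv (fun x => (h (x, σ2)).2) x) x := by
    filter_upwards [hinvl, hline.eventually hball, hγ.eventually (by simp)] with x hx hxb hxd k
    have hxd' := hxd.differentiableAt (by simp)
    have hd : HasDerivAt (fun x : ℝ => h (x, σ2))
        (deriv (fun x => (h (x, σ2)).1) x, deriv (fun x => (h (x, σ2)).2) x) x :=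
      hxd'.fst.hasDerivAt.prodMk hxd'.snd.hasDerivAt
    have := (hasFDerivAt_tiltMoment hc hc1 hint k hxb).comp_hasDerivAt x hd
    rw [hx.1, hx.2] at this
    simpa [Function.comp_def] using this
  have eq₁ : ∀ᶠ x in 𝓝 (0 : ℝ), deriv (fun x => (h (x, σ2)).1) x * (σ2 - x ^ 2) +
      deriv (fun x => (h (x, σ2)).2) x * (tiltMoment ρ 3 (h (x, σ2)) - σ2 * x) = 1 := by
    filter_upwards [hmd, hinvl.eventually_nhds] with x hx hi
    have h1 := (hx 1).unique ((hasDerivAt_id x).congr_of_eventuallyEq (hi.mono fun y hy => hy.1))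
    rw [hi.self_of_nhds.1, hi.self_of_nhds.2] at h1
    linarith
  have eq₂ : ∀ᶠ x in 𝓝 (0 : ℝ), deriv (fun x => (h (x, σ2)).1) x *
      (tiltMoment ρ 3 (h (x, σ2)) - σ2 * x) +
      deriv (fun x => (h (x, σ2)).2) x * (tiltMoment ρ 4 (h (x, σ2)) - σ2 ^ 2) = 0 := by
    filter_upwards [hmd, hinvl.eventually_nhds] with x hx hi
    have h2 := (hx 2).unique
      ((hasDerivAt_const x σ2).congr_of_eventuallyEq (hi.mono fun y hy => hy.2))
    rw [hi.self_of_nhds.2] at h2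
    linarith
  have hd₃ : deriv (fun x : ℝ => tiltMoment ρ 3 (h (x, σ2))) 0 =
      deriv (fun x => (h (x, σ2)).1) 0 * μ4 +
        deriv (fun x => (h (x, σ2)).2) 0 * tiltMoment ρ 5 0 := by
    rw [(hmd.self_of_nhds 3).deriv, hzero, t₃, t₄]
    ring
  obtain ⟨hb2, ha3⟩ := iterate_deriv_of_linear_system hs hv ha hb (hm 3) (hm 4)
    (by rw [hzero, t₃]) (by rw [hzero, t₄]) hd₃ eq₁ eq₂
  have hy : (fun x => deriv (fun y => (cramCW ρ x y).toReal) σ2) =ᶠ[𝓝 0]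
      fun x => (h (x, σ2)).2 := by
    filter_upwards [hline.eventually hF] with x hx
    have := hx.comp_hasDerivAt σ2 ((hasDerivAt_const σ2 x).prodMk (hasDerivAt_id σ2))
    simpa [Function.comp_def] using this.deriv
  have hx : deriv (fun x => (cramCW ρ x σ2).toReal) =ᶠ[𝓝 0] fun x => (h (x, σ2)).1 := by
    filter_upwards [hline.eventually hF] with x hx
    have := hx.comp_hasDerivAt x ((hasDerivAt_id x).prodMk (hasDerivAt_const x σ2))
    simpa [Function.comp_def] using this.deriv
  constructor
  · rw [← hb2]
    exact hy.deriv.deriv_eq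
  · rw [← ha3]
    exact hx.deriv.deriv.deriv_eq
end
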